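/- Suppose Γ: {ω·2, ω*·2} ≤_c {ω·3, ω*·3}. Then for every copy A of ω, Γ(A) is a linear order of type ω; in particular no copy A of ω has Γ(A) containing a suborder of type ω·2 or of type ω+1. -/

import Mathlib

/-- A finite linear order: a finite piece of an atomic diagram in the language `{<}`,
with domain a finite set of naturals. -/
structure FinLO where
  dom : Finset ℕ
  rel : ℕ → ℕ → Prop
  irrefl : ∀ x ∈ dom, ¬ rel x x
  trans : ∀ x ∈ dom, ∀ y ∈ dom, ∀ z ∈ dom, rel x y → rel y z → rel x z
  total : ∀ x ∈ dom, ∀ y ∈ dom, x ≠ y → rel x y ∨ rel y x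

/-- `β` extends `α` as a finite atomic diagram. -/
def FinLO.Ext (α β : FinLO) : Prop :=
  α.dom ⊆ β.dom ∧ ∀ x ∈ α.dom, ∀ y ∈ α.dom, (α.rel x y ↔ β.rel x y)

/-- An enumeration operator on finite linear orders: it monotonically enumerates
membership facts `x ∈ Γ(α)`, positive atomic facts `x < y` and negative atomic
facts `¬ x < y`. -/
structure EnumOp where
  mem : FinLO → Set ℕ
  pos : FinLO → Set (ℕ × ℕ)
  neg : FinLO → Set (ℕ × ℕ)
  mono_mem : ∀ {α β : FinLO}, α.Ext β → mem α ⊆ mem β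
  mono_pos : ∀ {α β : FinLO}, α.Ext β → pos α ⊆ pos β
  mono_neg : ∀ {α β : FinLO}, α.Ext β → neg α ⊆ neg β

/-- The outputs of `Γ` are consistent with being part of the atomic diagram of
a linear order. -/
def EnumOp.Consistent (Γ : EnumOp) : Prop :=
  ∀ α : FinLO, (∀ x : ℕ, (x, x) ∉ Γ.pos α) ∧
    (∀ x y : ℕ, ¬ ((x, y) ∈ Γ.pos α ∧ (y, x) ∈ Γ.pos α)) ∧
    (∀ x y : ℕ, ¬ ((x, y) ∈ Γ.pos α ∧ (x, y) ∈ Γ.neg α))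

/-- `α ⊩_Γ x < y` : both `x` and `y` occur in `Γ(α)` and no extension `β ⊇ α`
has `Γ(β) ⊨ ¬ (x < y)`. -/
def EnumOp.Forces (Γ : EnumOp) (α : FinLO) (x y : ℕ) : Prop :=
  x ∈ Γ.mem α ∧ y ∈ Γ.mem α ∧ ∀ β : FinLO, α.Ext β → (x, y) ∉ Γ.neg β

/-- Every pair of distinct elements occurring in `Γ(α)` is decided by some
extension of `α`. -/
def EnumOp.Decides (Γ : EnumOp) : Prop :=
  ∀ α : FinLO, ∀ x ∈ Γ.mem α, ∀ y ∈ Γ.mem α, x ≠ y →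
    ∃ β : FinLO, α.Ext β ∧ ((x, y) ∈ Γ.pos β ∨ (x, y) ∈ Γ.neg β)

/-- A (possibly infinite) diagram in the language `{<}` with domain a set of naturals. -/
structure LinDiag where
  dom : Set ℕ
  rel : ℕ → ℕ → Prop

/-- `α` is a finite subdiagram of `L`. -/
def FinLO.SubDiag (α : FinLO) (L : LinDiag) : Prop :=
  ↑α.dom ⊆ L.dom ∧ ∀ x ∈ α.dom, ∀ y ∈ α.dom, (α.rel x y ↔ L.rel x y)

/-- Membership facts enumerated by `Γ` on the infinite diagram `L`. -/
def EnumOp.memD (Γ : EnumOp) (L : LinDiag) : Set ℕ :=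
  {x | ∃ α : FinLO, α.SubDiag L ∧ x ∈ Γ.mem α}

/-- Positive facts `x < y` enumerated by `Γ` on the infinite diagram `L`. -/
def EnumOp.posD (Γ : EnumOp) (L : LinDiag) : Set (ℕ × ℕ) :=
  {p | ∃ α : FinLO, α.SubDiag L ∧ p ∈ Γ.pos α}

/-- Negative facts `¬ x < y` enumerated by `Γ` on the infinite diagram `L`. -/
def EnumOp.negD (Γ : EnumOp) (L : LinDiag) : Set (ℕ × ℕ) :=
  {p | ∃ α : FinLO, α.SubDiag L ∧ p ∈ Γ.neg α}

/-- `L` is (the atomic diagram of) a copy of the linear order `τ`. -/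
def IsCopy (τ : Type) [LinearOrder τ] (L : LinDiag) : Prop :=
  ∃ f : τ → ℕ, Function.Injective f ∧ Set.range f = L.dom ∧
    ∀ i j : τ, (L.rel (f i) (f j) ↔ i < j)

/-- The output of `Γ` on `L` is (the atomic diagram of) a copy of the linear
order `σ`. -/
def EnumOp.OutCopy (Γ : EnumOp) (σ : Type) [LinearOrder σ] (L : LinDiag) : Prop :=
  ∃ g : σ → ℕ, Function.Injective g ∧ Γ.memD L = Set.range g ∧
    (∀ a b : σ, ((g a, g b) ∈ Γ.posD L ↔ a < b)) ∧
    (∀ a b : σ, ((g a, g b) ∈ Γ.negD L ↔ ¬ a < b))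

/-- `Γ` is a computable embedding of the pair `{A, B}` into the pair `{C, D}`:
it maps every copy of `A` to a copy of `C` and every copy of `B` to a copy of `D`. -/
def EnumOp.Embeds (Γ : EnumOp) (A B C D : Type) [LinearOrder A] [LinearOrder B]
    [LinearOrder C] [LinearOrder D] : Prop :=
  (∀ L : LinDiag, IsCopy A L → Γ.OutCopy C L) ∧
  (∀ L : LinDiag, IsCopy B L → Γ.OutCopy D L)

/-- The output of `Γ` on `L` is a linear order of order type `σ` (ordered by the
enumerated positive facts). -/
def EnumOp.OutOfType (Γ : EnumOp) (σ : Type) [LinearOrder σ] (L : LinDiag) : Prop :=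
  ∃ g : σ → ℕ, Function.Injective g ∧ Γ.memD L = Set.range g ∧
    ∀ a b : σ, ((g a, g b) ∈ Γ.posD L ↔ a < b)

/-- The output of `Γ` on `L` contains a suborder of type `σ`. -/
def EnumOp.OutContains (Γ : EnumOp) (σ : Type) [LinearOrder σ] (L : LinDiag) : Prop :=
  ∃ g : σ → ℕ, Function.Injective g ∧ Set.range g ⊆ Γ.memD L ∧
    ∀ a b : σ, a < b → (g a, g b) ∈ Γ.posD L

section embedding

open Set

namespace LinDiag

/-- `L` is a subdiagram of `L'`. -/
def Sub (L L' : LinDiag) : Prop :=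
  L.dom ⊆ L'.dom ∧ ∀ x ∈ L.dom, ∀ y ∈ L.dom, (L.rel x y ↔ L'.rel x y)

theorem Sub.trans {L₁ L₂ L₃ : LinDiag} (h : L₁.Sub L₂) (h' : L₂.Sub L₃) : L₁.Sub L₃ :=
  ⟨h.1.trans h'.1, fun x hx y hy =>
    (h.2 x hx y hy).trans (h'.2 x (h.1 hx) y (h.1 hy))⟩

theorem Sub.subDiag {L L' : LinDiag} (h : L.Sub L') {α : FinLO} (hα : α.SubDiag L) :
    α.SubDiag L' :=
  ⟨hα.1.trans h.1, fun x hx y hy =>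
    (hα.2 x hx y hy).trans (h.2 x (hα.1 hx) y (hα.1 hy))⟩

theorem Sub.memD {L L' : LinDiag} (h : L.Sub L') (Γ : EnumOp) : Γ.memD L ⊆ Γ.memD L' :=
  fun _ ⟨α, hα, hx⟩ => ⟨α, h.subDiag hα, hx⟩

theorem Sub.posD {L L' : LinDiag} (h : L.Sub L') (Γ : EnumOp) : Γ.posD L ⊆ Γ.posD L' :=
  fun _ ⟨α, hα, hx⟩ => ⟨α, h.subDiag hα, hx⟩

end LinDiag

theorem EnumOp.OutCopy.exists_rank {Γ : EnumOp} {σ : Type} [LinearOrder σ] [Nonempty σ]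
    {L : LinDiag} (h : Γ.OutCopy σ L) :
    ∃ b : ℕ → σ, InjOn b (Γ.memD L) ∧
      ∀ x ∈ Γ.memD L, ∀ y ∈ Γ.memD L, ((x, y) ∈ Γ.posD L ↔ b x < b y) := by
  obtain ⟨g, gi, gr, gp, -⟩ := h
  refine ⟨Function.invFun g, ?_, ?_⟩
  · rw [gr]
    rintro _ ⟨a, rfl⟩ _ ⟨b, rfl⟩ hab
    exact congrArg g (by simpa [Function.leftInverse_invFun gi _] using hab)
  · rw [gr]
    rintro _ ⟨a, rfl⟩ _ ⟨b, rfl⟩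
    simpa [Function.leftInverse_invFun gi _] using gp a b

theorem EnumOp.OutCopy.decides {Γ : EnumOp} {σ : Type} [LinearOrder σ] [Nonempty σ]
    {L : LinDiag} (h : Γ.OutCopy σ L) {x y : ℕ} (hx : x ∈ Γ.memD L) (hy : y ∈ Γ.memD L)
    (hxy : x ≠ y) : (x, y) ∈ Γ.posD L ∨ (y, x) ∈ Γ.posD L := by
  obtain ⟨b, bi, bp⟩ := h.exists_rank
  rw [bp x hx y hy, bp y hy x hx]
  exact lt_or_gt_of_ne fun e => hxy (bi hx hy e)

theorem exists_enumeration_of_finite_initial (S : Set ℕ) (r : ℕ → ℕ → Prop) (cls : ℕ → Fin 2)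
    (irr : ∀ a ∈ S, ¬ r a a)
    (tr : ∀ a ∈ S, ∀ b ∈ S, ∀ c ∈ S, r a b → r b c → r a c)
    (tot : ∀ a ∈ S, ∀ b ∈ S, a ≠ b → r a b ∨ r b a)
    (mono : ∀ a ∈ S, ∀ b ∈ S, r a b → cls a ≤ cls b)
    (inf : ∀ c, {a | a ∈ S ∧ cls a = c}.Infinite)
    (fin : ∀ a ∈ S, {b | b ∈ S ∧ cls b = cls a ∧ r b a}.Finite) :
    ∃ f : Lex (Fin 2 × ℕ) → ℕ, Function.Injective f ∧ range f = S ∧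
      ∀ i j, r (f i) (f j) ↔ i < j := by
  classical
  set rk : ℕ → ℕ := fun a => {b | b ∈ S ∧ cls b = cls a ∧ r b a}.ncard with hrk
  have rk_lt : ∀ a ∈ S, ∀ b ∈ S, cls a = cls b → r a b → rk a < rk b := by
    intro a ha b hb hc hab
    apply Set.ncard_lt_ncard _ (fin b hb)
    refine ⟨fun x hx => ⟨hx.1, hx.2.1.trans hc, tr _ hx.1 _ ha _ hb hx.2.2 hab⟩, fun h => ?_⟩
    exact irr a ha (h (⟨ha, hc, hab⟩ : a ∈ {x | x ∈ S ∧ cls x = cls b ∧ r x b})).2.2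
  have rk_iff : ∀ a ∈ S, ∀ b ∈ S, cls a = cls b → (r a b ↔ rk a < rk b) := by
    intro a ha b hb hc
    refine ⟨rk_lt a ha b hb hc, fun h => ?_⟩
    rcases eq_or_ne a b with rfl | hne
    · exact absurd h (lt_irrefl _)
    · exact (tot a ha b hb hne).resolve_right fun h' =>
        lt_asymm h (rk_lt b hb a ha hc.symm h')
  have rk_inj : ∀ a ∈ S, ∀ b ∈ S, cls a = cls b → rk a = rk b → a = b := by
    intro a ha b hb hc h
    by_contra hne
    rcases tot a ha b hb hne with h' | h'
    · exact absurd h (rk_lt a ha b hb hc h').ne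
    · exact absurd h (rk_lt b hb a ha hc.symm h').ne'
  let N : Fin 2 → Set ℕ := fun c => rk '' {a | a ∈ S ∧ cls a = c}
  have hN : ∀ c, Infinite (N c) := fun c =>
    ((inf c).image fun a ha b hb h =>
      rk_inj a ha.1 b hb.1 (ha.2.trans hb.2.symm) h).to_subtype
  let e : ∀ c, ℕ ≃o N c := fun c => Nat.Subtype.orderIsoOfNat (N c)
  have hex : ∀ i : Lex (Fin 2 × ℕ), ∃ a, (a ∈ S ∧ cls a = (ofLex i).1) ∧
      rk a = (e (ofLex i).1 (ofLex i).2 : ℕ) := fun i =>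
    (e (ofLex i).1 (ofLex i).2).2
  choose f hf hfr using hex
  have key : ∀ i j, r (f i) (f j) ↔ i < j := by
    intro i j
    rw [Prod.Lex.lt_iff]
    rcases lt_trichotomy (ofLex i).1 (ofLex j).1 with h | h | h
    · refine ⟨fun _ => Or.inl h, fun _ => ?_⟩
      have hc : cls (f i) < cls (f j) := by rw [(hf i).2, (hf j).2]; exact h
      refine (tot _ (hf i).1 _ (hf j).1 fun e => by simp [e] at hc).resolve_right fun h' => ?_
      exact absurd (mono _ (hf j).1 _ (hf i).1 h') hc.not_ge
    · rw [rk_iff _ (hf i).1 _ (hf j).1 (by rw [(hf i).2, (hf j).2, h]), hfr, hfr]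
      simp only [h, lt_self_iff_false, true_and, false_or]
      have : ∀ c c' n m, c = c' → (((e c n : N c) : ℕ) < (e c' m : N c') ↔ n < m) := by
        rintro c _ n m rfl
        exact (e c).lt_iff_lt
      exact this _ _ _ _ h
    · refine ⟨fun h' => ?_, fun h' => ?_⟩
      · have := mono _ (hf i).1 _ (hf j).1 h'
        rw [(hf i).2, (hf j).2] at this
        exact absurd this h.not_ge
      · rcases h' with h' | h'
        · exact absurd h' h.asymm
        · exact absurd h'.1 h.ne'
  refine ⟨f, fun i j hij => ?_, ?_, key⟩
  · rcases lt_trichotomy i j with h | h | h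
    · exact absurd ((key i j).2 h) (by rw [hij]; exact irr _ (hf j).1)
    · exact h
    · exact absurd ((key j i).2 h) (by rw [hij]; exact irr _ (hf j).1)
  · ext a
    refine ⟨by rintro ⟨i, rfl⟩; exact (hf i).1, fun ha => ?_⟩
    have hm : rk a ∈ N (cls a) := ⟨a, ⟨ha, rfl⟩, rfl⟩
    let n := (e (cls a)).symm ⟨rk a, hm⟩
    refine ⟨toLex (cls a, n), rk_inj _ (hf _).1 _ ha (hf _).2 ?_⟩
    rw [hfr]
    exact congrArg Subtype.val ((e (cls a)).apply_symm_apply ⟨rk a, hm⟩)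

/-- A set of labels, split into a lower and an upper part, with an order inside each part. -/
structure Block where
  dom : Set ℕ
  part : ℕ → Bool
  key : ℕ → ℤ
  inj : ∀ a ∈ dom, ∀ b ∈ dom, part a = part b → key a = key b → a = b

namespace Block

/-- A finite block both of whose parts are inhabited. -/
structure Proper (B : Block) : Prop where
  fin : B.dom.Finite
  ne : ∀ s, ∃ a ∈ B.dom, B.part a = s

/-- The block `C` extends the block `B`. -/
structure Le (B C : Block) : Prop where
  dom : B.dom ⊆ C.dom
  part : ∀ a ∈ B.dom, B.part a = C.part a
  key : ∀ a ∈ B.dom, B.key a = C.key a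

theorem Le.refl (B : Block) : B.Le B := ⟨subset_rfl, fun _ _ => rfl, fun _ _ => rfl⟩

theorem Le.trans {B C D : Block} (h : B.Le C) (h' : C.Le D) : B.Le D :=
  ⟨h.dom.trans h'.dom, fun a ha => (h.part a ha).trans (h'.part a (h.dom ha)),
    fun a ha => (h.key a ha).trans (h'.key a (h.dom ha))⟩

variable {ι κ Q R : Type} [LinearOrder Q] [LinearOrder R]

/-- The position of the label `a` of the block `B i` in the layout `p`. -/
def loc (B : ι → Block) (p : ι → Bool → Q) (i : ι) (a : ℕ) : Lex (Q × ℤ) :=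
  toLex (p i ((B i).part a), (B i).key a)

/-- The diagram in which the part `s` of the block `B i` is put at position `p i s`. -/
def lay (B : ι → Block) (p : ι → Bool → Q) : LinDiag where
  dom := ⋃ i, (B i).dom
  rel a b := ∃ i j, a ∈ (B i).dom ∧ b ∈ (B j).dom ∧ loc B p i a < loc B p j b

/-- The blocks of a family are pairwise disjoint. -/
def Disj (B : ι → Block) : Prop := ∀ i j a, a ∈ (B i).dom → a ∈ (B j).dom → i = j

theorem lay_rel {B : ι → Block} (hB : Disj B) (p : ι → Bool → Q) {i j : ι} {a b : ℕ}
    (ha : a ∈ (B i).dom) (hb : b ∈ (B j).dom) :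
    (lay B p).rel a b ↔ loc B p i a < loc B p j b := by
  constructor
  · rintro ⟨k, l, hk, hl, h⟩
    rwa [hB i k a ha hk, hB j l b hb hl]
  · exact fun h => ⟨i, j, ha, hb, h⟩

theorem lay_sub {B : ι → Block} {C : κ → Block} (hC : Disj C) {p : ι → Bool → Q}
    {p' : κ → Bool → R} (f : ι → κ) (hf : ∀ i, (B i).Le (C (f i)))
    (hp : ∀ i s j t, p i s < p j t ↔ p' (f i) s < p' (f j) t) :
    (lay B p).Sub (lay C p') := by
  have hloc : ∀ i j a b, a ∈ (B i).dom → b ∈ (B j).dom →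
      (loc B p i a < loc B p j b ↔ loc C p' (f i) a < loc C p' (f j) b) := by
    intro i j a b ha hb
    have heq : ∀ s t, p i s = p j t ↔ p' (f i) s = p' (f j) t := fun s t => by
      simp only [le_antisymm_iff, ← not_lt, hp]
    simp only [loc, Prod.Lex.toLex_lt_toLex, (hf i).part a ha, (hf j).part b hb,
      (hf i).key a ha, (hf j).key b hb, hp, heq]
  have hdom : (lay B p).dom ⊆ (lay C p').dom := by
    intro a ha
    obtain ⟨i, hi⟩ := mem_iUnion.1 ha
    exact mem_iUnion.2 ⟨f i, (hf i).dom hi⟩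
  refine ⟨hdom, fun a ha b hb => ⟨?_, fun h => ?_⟩⟩
  · rintro ⟨i, j, hi, hj, h⟩
    exact ⟨f i, f j, (hf i).dom hi, (hf j).dom hj, (hloc i j a b hi hj).1 h⟩
  · obtain ⟨i, hi⟩ := mem_iUnion.1 ha
    obtain ⟨j, hj⟩ := mem_iUnion.1 hb
    rw [lay_rel hC p' ((hf i).dom hi) ((hf j).dom hj)] at h
    exact ⟨i, j, hi, hj, (hloc i j a b hi hj).2 h⟩

/-- Distinct parts get distinct positions. -/
def PInj (p : ι → Bool → Q) : Prop := ∀ i s j t, p i s = p j t → i = j ∧ s = t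

section copies

variable {B : ι → Block} {p : ι → Bool → Q}

theorem lay_irrefl (hB : Disj B) (a : ℕ) : ¬ (lay B p).rel a a := by
  rintro ⟨i, j, hi, hj, h⟩
  rw [hB i j a hi hj] at h
  exact lt_irrefl _ h

theorem lay_trans (hB : Disj B) {a b c : ℕ} (h : (lay B p).rel a b) (h' : (lay B p).rel b c) :
    (lay B p).rel a c := by
  obtain ⟨i, j, hi, hj, h⟩ := h
  obtain ⟨k, l, hk, hl, h'⟩ := h'
  rw [hB k j b hk hj] at h'
  exact ⟨i, l, hi, hl, h.trans h'⟩

theorem lay_total (hp : PInj p) {a b : ℕ} (ha : a ∈ (lay B p).dom)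
    (hb : b ∈ (lay B p).dom) (hab : a ≠ b) : (lay B p).rel a b ∨ (lay B p).rel b a := by
  obtain ⟨i, hi⟩ := mem_iUnion.1 ha
  obtain ⟨j, hj⟩ := mem_iUnion.1 hb
  rcases lt_trichotomy (loc B p i a) (loc B p j b) with h | h | h
  · exact Or.inl ⟨i, j, hi, hj, h⟩
  · exfalso
    simp only [loc, EmbeddingLike.apply_eq_iff_eq, Prod.mk.injEq] at h
    obtain ⟨rfl, h1⟩ := hp _ _ _ _ h.1
    exact hab ((B i).inj a hi b hj h1 h.2)
  · exact Or.inr ⟨j, i, hj, hi, h⟩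

theorem exists_cls (hB : Disj B) (cls : ι → Bool → Fin 2) :
    ∃ c : ℕ → Fin 2, ∀ i, ∀ a ∈ (B i).dom, c a = cls i ((B i).part a) := by
  classical
  refine ⟨fun a => if h : ∃ i, a ∈ (B i).dom then cls h.choose ((B h.choose).part a) else 0,
    fun i a ha => ?_⟩
  have h : ∃ i, a ∈ (B i).dom := ⟨i, ha⟩
  have : h.choose = i := hB _ _ a h.choose_spec ha
  simp only [dif_pos h, this]

theorem isCopy_lay (hB : Disj B) (hp : PInj p) (cls : ι → Bool → Fin 2)
    (mono : ∀ i s j t, p i s < p j t → cls i s ≤ cls j t)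
    (inf : ∀ c, {a | ∃ i, a ∈ (B i).dom ∧ cls i ((B i).part a) = c}.Infinite)
    (fin : ∀ i, ∀ a ∈ (B i).dom, {b | ∃ j, b ∈ (B j).dom ∧
      cls j ((B j).part b) = cls i ((B i).part a) ∧ loc B p j b < loc B p i a}.Finite) :
    IsCopy (Lex (Fin 2 × ℕ)) (lay B p) := by
  obtain ⟨c, hc⟩ := exists_cls hB cls
  refine exists_enumeration_of_finite_initial _ _ c (fun a _ => lay_irrefl hB a)
    (fun _ _ _ _ _ _ => lay_trans hB) (fun a ha b hb => lay_total hp ha hb) ?_ ?_ ?_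
  · rintro a - b - ⟨i, j, hi, hj, h⟩
    rw [hc i a hi, hc j b hj]
    rcases Prod.Lex.lt_iff.1 h with h | h
    · exact mono _ _ _ _ h
    · obtain ⟨h1, h2⟩ := hp _ _ _ _ h.1
      subst h1
      exact le_of_eq (congrArg _ h2)
  · refine fun k => (inf k).mono ?_
    rintro a ⟨i, hi, h⟩
    exact ⟨mem_iUnion.2 ⟨i, hi⟩, (hc i a hi).trans h⟩
  · intro a ha
    obtain ⟨i, hi⟩ := mem_iUnion.1 ha
    refine (fin i a hi).subset ?_
    rintro b ⟨hb, h, h'⟩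
    obtain ⟨j, hj⟩ := mem_iUnion.1 hb
    exact ⟨j, hj, by rw [← hc j b hj, ← hc i a hi, h], (lay_rel hB p hj hi).1 h'⟩

theorem isCopy_lay_dual (hB : Disj B) (hp : PInj p) (cls : ι → Bool → Fin 2)
    (mono : ∀ i s j t, p i s < p j t → cls j t ≤ cls i s)
    (inf : ∀ c, {a | ∃ i, a ∈ (B i).dom ∧ cls i ((B i).part a) = c}.Infinite)
    (fin : ∀ i, ∀ a ∈ (B i).dom, {b | ∃ j, b ∈ (B j).dom ∧
      cls j ((B j).part b) = cls i ((B i).part a) ∧ loc B p i a < loc B p j b}.Finite) :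
    IsCopy (Lex (Fin 2 × ℕ))ᵒᵈ (lay B p) := by
  obtain ⟨c, hc⟩ := exists_cls hB cls
  have : ∃ f : Lex (Fin 2 × ℕ) → ℕ, Function.Injective f ∧ range f = (lay B p).dom ∧
      ∀ i j, (lay B p).rel (f j) (f i) ↔ i < j := by
    refine exists_enumeration_of_finite_initial _ (fun a b => (lay B p).rel b a) c
      (fun a _ => lay_irrefl hB a)
      (fun _ _ _ _ _ _ h h' => lay_trans hB h' h)
      (fun a ha b hb hab => (lay_total hp ha hb hab).symm) ?_ ?_ ?_
    · rintro a - b - ⟨i, j, hi, hj, h⟩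
      rw [hc i b hi, hc j a hj]
      rcases Prod.Lex.lt_iff.1 h with h | h
      · exact mono _ _ _ _ h
      · obtain ⟨h1, h2⟩ := hp _ _ _ _ h.1
        subst h1
        exact le_of_eq (congrArg _ h2.symm)
    · refine fun k => (inf k).mono ?_
      rintro a ⟨i, hi, h⟩
      exact ⟨mem_iUnion.2 ⟨i, hi⟩, (hc i a hi).trans h⟩
    · intro a ha
      obtain ⟨i, hi⟩ := mem_iUnion.1 ha
      refine (fin i a hi).subset ?_
      rintro b ⟨hb, h, h'⟩
      obtain ⟨j, hj⟩ := mem_iUnion.1 hb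
      exact ⟨j, hj, by rw [← hc j b hj, ← hc i a hi, h], (lay_rel hB p hi hj).1 h'⟩
  obtain ⟨f, fi, fr, fp⟩ := this
  exact ⟨fun i => f (OrderDual.ofDual i), fun i j h => fi h,
    by rw [← fr]; exact OrderDual.ofDual.surjective.range_comp f, fun i j => fp _ _⟩

end copies

section sequences

variable {ι : Type} {B : ι → Block} {p : ι → Bool → Lex (Fin 2 × ℕ)}

theorem infinite_class (hB : Disj B) (hP : ∀ i, (B i).Proper)
    (hinf : ∀ c, {i | ∃ s, (ofLex (p i s)).1 = c}.Infinite) (c : Fin 2) :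
    {a | ∃ i, a ∈ (B i).dom ∧ (ofLex (p i ((B i).part a))).1 = c}.Infinite := by
  have : ∀ i : {i | ∃ s, (ofLex (p i s)).1 = c}, ∃ a, a ∈ (B i).dom ∧
      (ofLex (p i ((B i).part a))).1 = c := by
    rintro ⟨i, s, hs⟩
    obtain ⟨a, ha, rfl⟩ := (hP i).ne s
    exact ⟨a, ha, hs⟩
  choose g hg hgc using this
  have := (hinf c).to_subtype
  refine (infinite_range_of_injective (f := g) fun i j h => ?_).mono ?_
  · exact Subtype.ext (hB _ _ _ (hg i) (by rw [h]; exact hg j))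
  · rintro _ ⟨i, rfl⟩
    exact ⟨i, hg i, hgc i⟩

theorem finite_below (hP : ∀ i, (B i).Proper) (hp : PInj p) (q : Lex (Fin 2 × ℕ)) :
    {b | ∃ j, b ∈ (B j).dom ∧ (ofLex (p j ((B j).part b))).1 = (ofLex q).1 ∧
      p j ((B j).part b) ≤ q}.Finite := by
  have h1 : {r : Lex (Fin 2 × ℕ) | (ofLex r).1 = (ofLex q).1 ∧ r ≤ q}.Finite := by
    refine ((finite_Iic (ofLex q).2).image fun m => toLex ((ofLex q).1, m)).subset ?_
    rintro r ⟨h, h'⟩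
    refine ⟨(ofLex r).2, ?_, by rw [← h]; rfl⟩
    rcases Prod.Lex.le_iff.1 h' with h' | h'
    · exact absurd h h'.ne
    · exact h'.2
  have h2 : {x : ι × Bool | (ofLex (p x.1 x.2)).1 = (ofLex q).1 ∧ p x.1 x.2 ≤ q}.Finite :=
    h1.preimage fun x _ y _ h => Prod.ext (hp _ _ _ _ h).1 (hp _ _ _ _ h).2
  refine (h2.biUnion fun x _ => (hP x.1).fin).subset ?_
  rintro b ⟨j, hj, h⟩
  exact mem_biUnion (x := (j, (B j).part b)) h hj

theorem isCopy_of_position (hB : Disj B) (hP : ∀ i, (B i).Proper) (hp : PInj p)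
    (hinf : ∀ c, {i | ∃ s, (ofLex (p i s)).1 = c}.Infinite) :
    IsCopy (Lex (Fin 2 × ℕ)) (lay B p) := by
  refine isCopy_lay hB hp (fun i s => (ofLex (p i s)).1) ?_ (infinite_class hB hP hinf) ?_
  · intro i s j t h
    rcases Prod.Lex.lt_iff.1 h with h | h
    exacts [h.le, h.1.le]
  · intro i a _
    refine (finite_below hP hp (p i ((B i).part a))).subset ?_
    rintro b ⟨j, hj, h, h'⟩
    refine ⟨j, hj, h, ?_⟩
    rcases Prod.Lex.lt_iff.1 h' with h' | h'
    exacts [le_of_lt h', le_of_eq h'.1]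

theorem isCopy_of_position_dual (hB : Disj B) (hP : ∀ i, (B i).Proper) (hp : PInj p)
    (hinf : ∀ c, {i | ∃ s, (ofLex (p i s)).1 = c}.Infinite) :
    IsCopy (Lex (Fin 2 × ℕ))ᵒᵈ (lay B fun i s => OrderDual.toDual (p i s)) := by
  refine isCopy_lay_dual hB hp (fun i s => (ofLex (p i s)).1) ?_
    (infinite_class hB hP hinf) ?_
  · intro i s j t h
    rcases Prod.Lex.lt_iff.1 (OrderDual.toDual_lt_toDual.1 h) with h | h
    exacts [h.le, h.1.le]
  · intro i a _
    refine (finite_below hP hp (p i ((B i).part a))).subset ?_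
    rintro b ⟨j, hj, h, h'⟩
    refine ⟨j, hj, h, ?_⟩
    rcases Prod.Lex.lt_iff.1 h' with h' | h'
    exacts [(OrderDual.toDual_lt_toDual.1 h').le, ge_of_eq (OrderDual.toDual_inj.1 h'.1)]

/-- All lower parts first, then all upper parts. -/
def split (m : ℕ) (s : Bool) : Lex (Fin 2 × ℕ) := toLex (if s then 1 else 0, m)

/-- Whole even blocks first, then whole odd blocks. -/
def parity (m : ℕ) (s : Bool) : Lex (Fin 2 × ℕ) :=
  toLex (if m % 2 = 0 then 0 else 1, 2 * m + if s then 1 else 0)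

theorem parity_lt (i : ℕ) (s : Bool) (j : ℕ) (t : Bool) : parity i s < parity j t ↔
    i % 2 < j % 2 ∨
      i % 2 = j % 2 ∧ (2 * i + if s then 1 else 0) < 2 * j + if t then 1 else 0 := by
  rcases Nat.mod_two_eq_zero_or_one i with h | h <;>
    rcases Nat.mod_two_eq_zero_or_one j with h' | h' <;>
    simp [parity, Prod.Lex.toLex_lt_toLex, h, h']

theorem pInj_split : PInj split := by
  intro i s j t h
  have h := congrArg ofLex h
  cases s <;> cases t <;> simp_all [split]

theorem pInj_parity : PInj parity := by
  intro i s j t h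
  have h := congrArg Prod.snd (congrArg ofLex h)
  cases s <;> cases t <;> simp [parity] at h ⊢ <;> omega

theorem infinite_split (c : Fin 2) : {i | ∃ s, (ofLex (split i s)).1 = c}.Infinite := by
  convert infinite_univ (α := ℕ)
  refine eq_univ_of_forall fun i => ?_
  fin_cases c
  exacts [⟨false, rfl⟩, ⟨true, rfl⟩]

theorem infinite_parity (c : Fin 2) : {i | ∃ s, (ofLex (parity i s)).1 = c}.Infinite := by
  refine (infinite_range_of_injective (f := fun n => 2 * n + (c : ℕ))
    fun a b h => by simpa using h).mono ?_
  rintro _ ⟨n, rfl⟩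
  refine ⟨false, ?_⟩
  fin_cases c <;> simp [parity]

theorem isCopy_split {B : ℕ → Block} (hB : Disj B) (hP : ∀ i, (B i).Proper) :
    IsCopy (Lex (Fin 2 × ℕ)) (lay B split) :=
  isCopy_of_position hB hP pInj_split infinite_split

theorem isCopy_split_dual {B : ℕ → Block} (hB : Disj B) (hP : ∀ i, (B i).Proper) :
    IsCopy (Lex (Fin 2 × ℕ))ᵒᵈ (lay B fun i s => OrderDual.toDual (split i !s)) := by
  refine isCopy_of_position_dual (p := fun i s => split i !s) hB hP
    (fun i s j t h => ?_) fun c => (infinite_split c).mono ?_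
  · have := pInj_split _ _ _ _ h
    exact ⟨this.1, Bool.not_inj this.2⟩
  · rintro i ⟨s, hs⟩
    exact ⟨!s, by simpa using hs⟩

theorem isCopy_parity {B : ℕ → Block} (hB : Disj B) (hP : ∀ i, (B i).Proper) :
    IsCopy (Lex (Fin 2 × ℕ)) (lay B parity) :=
  isCopy_of_position hB hP pInj_parity infinite_parity

end sequences

/-- Table of positions. -/
def tab {n : ℕ} (v : Fin n → ℕ × ℕ) (i : Fin n) (s : Bool) : ℕ := if s then (v i).2 else (v i).1

/-- A finite configuration of blocks is part of a copy of `ω·2`. -/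
theorem exists_copy_of_table {B : ℕ → Block} (hB : Disj B) (hP : ∀ i, (B i).Proper)
    {n : ℕ} (f : Fin n → ℕ) (hf : Function.Injective f) (v : Fin n → ℕ × ℕ)
    (hv : PInj (tab v)) (hb : ∀ i s, tab v i s < 8) :
    ∃ L, IsCopy (Lex (Fin 2 × ℕ)) L ∧ (lay (fun i => B (f i)) (tab v)).Sub L := by
  obtain ⟨K, hK⟩ : ∃ K, ∀ i, f i < K :=
    ⟨∑ i, (f i + 1), fun i => Finset.single_le_sum (f := fun i => f i + 1)
      (fun _ _ => Nat.zero_le _) (Finset.mem_univ i)⟩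
  let g : Fin n ⊕ ℕ → ℕ := Sum.elim f fun m => m + K
  have hg : Function.Injective g := by
    rintro (i | i) (j | j) h
    · exact congrArg _ (hf h)
    · have := hK i; simp only [g, Sum.elim_inl, Sum.elim_inr] at h; omega
    · have := hK j; simp only [g, Sum.elim_inl, Sum.elim_inr] at h; omega
    · simpa [g] using h
  let q : Fin n ⊕ ℕ → Bool → Lex (Fin 2 × ℕ) :=
    Sum.elim (fun i s => toLex (0, tab v i s)) fun m s => split (m + 8) s
  have hD : Disj fun x => B (g x) := fun i j a hi hj => hg (hB _ _ a hi hj)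
  refine ⟨lay (fun x => B (g x)) q, isCopy_of_position hD (fun _ => hP _) ?_ ?_, ?_⟩
  · rintro (i | i) s (j | j) t h
    · have h := congrArg Prod.snd (congrArg ofLex h)
      have := hv i s j t h
      exact ⟨congrArg _ this.1, this.2⟩
    · have h := congrArg Prod.snd (congrArg ofLex h)
      have := hb i s
      simp [q, split] at h
      omega
    · have h := congrArg Prod.snd (congrArg ofLex h)
      have := hb j t
      simp [q, split] at h
      omega
    · have := pInj_split _ _ _ _ h
      simpa using this
  · intro c
    refine (infinite_range_of_injective (f := (Sum.inr : ℕ → Fin n ⊕ ℕ))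
      Sum.inr_injective).mono ?_
    rintro _ ⟨m, rfl⟩
    fin_cases c
    exacts [⟨false, rfl⟩, ⟨true, rfl⟩]
  · refine lay_sub hD Sum.inl (fun i => Le.refl _) fun i s j t => ?_
    simp [q, Prod.Lex.toLex_lt_toLex]

end Block

/-- The hypothesis on the operator under consideration. -/
abbrev EnumOp.TwoToThree (Γ : EnumOp) : Prop :=
  Γ.Embeds (Lex (Fin 2 × ℕ)) ((Lex (Fin 2 × ℕ))ᵒᵈ) (Lex (Fin 3 × ℕ)) ((Lex (Fin 3 × ℕ))ᵒᵈ)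

theorem FinLO.SubDiag.of_sub {α : FinLO} {L L' : LinDiag} (h : α.SubDiag L') (hL : L.Sub L')
    (hα : ↑α.dom ⊆ L.dom) : α.SubDiag L :=
  ⟨hα, fun x hx y hy => (h.2 x hx y hy).trans (hL.2 x (hα hx) y (hα hy)).symm⟩

namespace Block

/-- The restriction of a block to a set of labels. -/
def restrict (B : Block) (S : Set ℕ) : Block where
  dom := S ∩ B.dom
  part := B.part
  key := B.key
  inj a ha b hb := B.inj a ha.2 b hb.2

theorem Le.proper_restrict {E C : Block} (h : E.Le C) (hE : E.Proper) {S : Set ℕ}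
    (hS : S.Finite) (hES : E.dom ⊆ S) : (C.restrict S).Proper := by
  refine ⟨hS.inter_of_left _, fun s => ?_⟩
  obtain ⟨a, ha, h'⟩ := hE.ne s
  exact ⟨a, ⟨hES ha, h.dom ha⟩, (h.part a ha).symm.trans h'⟩

theorem Le.restrict {E C : Block} (h : E.Le C) {S : Set ℕ} (hES : E.dom ⊆ S) :
    E.Le (C.restrict S) :=
  ⟨fun _ ha => ⟨hES ha, h.dom ha⟩, h.part, h.key⟩

theorem restrict_le (C : Block) (S : Set ℕ) : (C.restrict S).Le C :=
  ⟨fun _ ha => ha.2, fun _ _ => rfl, fun _ _ => rfl⟩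

theorem Disj.pair {E F : Block} (h : Disjoint E.dom F.dom) : Disj ![E, F] := by
  intro i j a hi hj
  fin_cases i <;> fin_cases j
  · rfl
  · exact absurd hj (disjoint_left.1 h hi)
  · exact absurd hi (disjoint_left.1 h hj)
  · rfl

/-- Two blocks laid out according to a table. -/
def two (E F : Block) (v : Fin 2 → ℕ × ℕ) : LinDiag := lay ![E, F] (tab v)

theorem two_sub {E E' F F' : Block} (hE : E.Le E') (hF : F.Le F')
    (h : Disjoint E'.dom F'.dom) (v : Fin 2 → ℕ × ℕ) : (two E F v).Sub (two E' F' v) := by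
  refine lay_sub (Disj.pair h) id (fun i => ?_) fun _ _ _ _ => Iff.rfl
  fin_cases i
  exacts [hE, hF]

/-- Extend a finite block by infinitely many labels in both parts, above or below all
the old ones according to `r`. -/
theorem exists_grow (E : Block) (hE : E.dom.Finite) (G : ℕ) (hG : ∀ a ∈ E.dom, a < G) (r : Bool) :
    ∃ (C : Block) (K : ℕ), E.Le C ∧ C.dom = E.dom ∪ Ici G ∧
      (∀ g ∈ Ici G, C.part g = decide (g % 2 = 1)) ∧
      ∀ g ∈ Ici G, C.key g = if r then (K + g : ℤ) else -(K + g : ℤ) := by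
  classical
  obtain ⟨K, hK⟩ : ∃ K : ℕ, ∀ a ∈ E.dom, (E.key a).natAbs ≤ K := by
    obtain ⟨K, hK⟩ := (hE.image fun a => (E.key a).natAbs).bddAbove
    exact ⟨K, fun a ha => hK ⟨a, ha, rfl⟩⟩
  have hnot : ∀ a ∈ E.dom, ¬ G ≤ a := fun a ha => (hG a ha).not_ge
  let part : ℕ → Bool := fun a => if G ≤ a then decide (a % 2 = 1) else E.part a
  let key : ℕ → ℤ := fun a => if G ≤ a then
    (if r then (K + 1 + a : ℤ) else -(K + 1 + a : ℤ)) else E.key a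
  refine ⟨⟨E.dom ∪ Ici G, part, key, ?_⟩, K + 1, ⟨subset_union_left, fun a ha => ?_, fun a ha => ?_⟩,
    rfl, fun g hg => ?_, fun g hg => ?_⟩
  · rintro a ha b hb hab h
    rcases ha with ha | ha <;> rcases hb with hb | hb
    · simp only [part, key, hnot a ha, hnot b hb, if_false] at hab h
      exact E.inj a ha b hb hab h
    · have := hK a ha
      simp only [key, hnot a ha, if_false, if_pos (mem_Ici.1 hb)] at h
      split_ifs at h <;> omega
    · have := hK b hb
      simp only [key, hnot b hb, if_false, if_pos (mem_Ici.1 ha)] at h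
      split_ifs at h <;> omega
    · simp only [key, if_pos (mem_Ici.1 ha), if_pos (mem_Ici.1 hb)] at h
      split_ifs at h <;> omega
  · simp [part, hnot a ha]
  · simp [key, hnot a ha]
  · simp [part, mem_Ici.1 hg]
  · simp [key, mem_Ici.1 hg]

/-- A comparison decided after infinitely many labels are added to the second block is
already decided after finitely many are. -/
theorem exists_decided_of_outCopy {Γ : EnumOp} {σ : Type} [LinearOrder σ] [Nonempty σ]
    {E F C : Block} (hE : E.Proper) {G : ℕ} (hFG : ∀ a ∈ F.dom, a < G)
    (hFE : Disjoint F.dom E.dom) (hEC : E.Le C) (hC : C.dom = E.dom ∪ Ici G)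
    {v : Fin 2 → ℕ × ℕ} (h : Γ.OutCopy σ (two F C v)) {x y : ℕ}
    (hx : x ∈ Γ.memD (two F E v)) (hy : y ∈ Γ.memD (two F E v)) (hxy : x ≠ y) :
    ∃ E' : Block, E.Le E' ∧ E'.Proper ∧ E'.dom ⊆ E.dom ∪ Ici G ∧
      ((x, y) ∈ Γ.posD (two F E' v) ∨ (y, x) ∈ Γ.posD (two F E' v)) := by
  have hFC : Disjoint F.dom C.dom := by
    rw [hC, disjoint_union_right]
    exact ⟨hFE, disjoint_left.2 fun a ha ha' => (hFG a ha).not_ge ha'⟩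
  have hs := two_sub (Le.refl F) hEC hFC v
  have key : ∀ p, p ∈ Γ.posD (two F C v) → ∃ E' : Block, E.Le E' ∧ E'.Proper ∧
      E'.dom ⊆ E.dom ∪ Ici G ∧ p ∈ Γ.posD (two F E' v) := by
    rintro p ⟨α, hα, hp⟩
    have hES : E.dom ⊆ E.dom ∪ α.dom := subset_union_left
    refine ⟨C.restrict (E.dom ∪ α.dom), hEC.restrict hES,
      hEC.proper_restrict hE (hE.fin.union α.dom.finite_toSet) hES, ?_, α, ?_, hp⟩
    · rw [← hC]; exact (restrict_le _ _).dom
    · refine hα.of_sub (two_sub (Le.refl F) (restrict_le C _) hFC v) fun a ha => ?_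
      obtain ⟨i, hi⟩ := mem_iUnion.1 (hα.1 ha)
      refine mem_iUnion.2 ⟨i, ?_⟩
      fin_cases i
      · exact hi
      · exact ⟨Or.inr ha, hi⟩
  rcases h.decides (hs.memD Γ hx) (hs.memD Γ hy) hxy with h | h
  · obtain ⟨E', h1, h2, h3, h4⟩ := key _ h
    exact ⟨E', h1, h2, h3, Or.inl h4⟩
  · obtain ⟨E', h1, h2, h3, h4⟩ := key _ h
    exact ⟨E', h1, h2, h3, Or.inr h4⟩

section grow

variable {E F C : Block} {G K : ℕ} {v : Fin 2 → ℕ × ℕ}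

theorem infinite_part (hC : C.dom = E.dom ∪ Ici G)
    (hpart : ∀ g ∈ Ici G, C.part g = decide (g % 2 = 1)) (s : Bool) :
    {a | a ∈ C.dom ∧ C.part a = s}.Infinite := by
  refine (infinite_range_of_injective (f := fun n => 2 * (G + n) + if s then 1 else 0)
    fun a b h => by simpa using h).mono ?_
  rintro _ ⟨n, rfl⟩
  have hm : 2 * (G + n) + (if s then 1 else 0) ∈ Ici G := by
    rw [mem_Ici]; omega
  refine ⟨by rw [hC]; exact Or.inr hm, ?_⟩
  beta_reduce
  rw [hpart _ hm]
  cases s <;> simp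

theorem finite_of_bound (hE : E.dom.Finite) (hF : F.dom.Finite)
    (hC : C.dom = E.dom ∪ Ici G) (P : Fin 2 → ℕ → Prop) (N : ℕ)
    (h : ∀ b ∈ Ici G, P 1 b → b ≤ N) :
    {b | ∃ j, b ∈ (![F, C] j).dom ∧ P j b}.Finite := by
  refine ((hE.union hF).union (finite_Iic N)).subset ?_
  rintro b ⟨j, hj, hb⟩
  fin_cases j
  · exact Or.inl (Or.inr hj)
  · have hj : b ∈ C.dom := hj
    rw [hC] at hj
    rcases hj with hj | hj
    · exact Or.inl (Or.inl hj)
    · exact Or.inr (h b hj hb)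

theorem isCopy_grow_right (hE : E.dom.Finite) (hF : F.dom.Finite) (hFC : Disjoint F.dom C.dom)
    (hC : C.dom = E.dom ∪ Ici G) (hpart : ∀ g ∈ Ici G, C.part g = decide (g % 2 = 1))
    (hkey : ∀ g ∈ Ici G, C.key g = (K + g : ℤ)) (hv : PInj (tab v))
    (hlt : tab v 1 false < tab v 1 true) (hlast : ∀ i s, tab v i s ≤ tab v 1 true) :
    IsCopy (Lex (Fin 2 × ℕ)) (two F C v) := by
  refine isCopy_lay (Disj.pair hFC) hv
    (fun i s => if tab v i s ≤ tab v 1 false then 0 else 1) ?_ ?_ ?_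
  · intro i s j t h
    split_ifs <;> simp
    omega
  · intro c
    refine (infinite_part hC hpart (if c = 0 then false else true)).mono ?_
    rintro a ⟨ha, hs⟩
    refine ⟨1, ha, ?_⟩
    change (if tab v 1 (C.part a) ≤ tab v 1 false then _ else _) = _
    rw [hs]
    fin_cases c <;> simp [hlt]
  · intro i a _
    refine finite_of_bound hE hF hC (fun j b => _ ∧ loc ![F, C] (tab v) j b < _)
      ((![F, C] i).key a).toNat ?_
    rintro b hb ⟨h1, h2⟩
    change (if tab v 1 (C.part b) ≤ tab v 1 false then (0 : Fin 2) else 1) = _ at h1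
    replace h2 := Prod.Lex.lt_iff.1 h2
    change tab v 1 (C.part b) < tab v i ((![F, C] i).part a) ∨
      tab v 1 (C.part b) = tab v i ((![F, C] i).part a) ∧ C.key b < (![F, C] i).key a at h2
    rw [hkey b hb] at h2
    have := hlast i ((![F, C] i).part a)
    cases hs : C.part b <;> rw [hs] at h1 h2
    · split_ifs at h1 <;> omega
    · omega

theorem isCopy_grow_left (hE : E.dom.Finite) (hF : F.dom.Finite) (hFC : Disjoint F.dom C.dom)
    (hC : C.dom = E.dom ∪ Ici G) (hpart : ∀ g ∈ Ici G, C.part g = decide (g % 2 = 1))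
    (hkey : ∀ g ∈ Ici G, C.key g = -(K + g : ℤ)) (hv : PInj (tab v))
    (hlt : tab v 1 false < tab v 1 true) (hfirst : ∀ i s, tab v 1 false ≤ tab v i s) :
    IsCopy (Lex (Fin 2 × ℕ))ᵒᵈ (two F C v) := by
  refine isCopy_lay_dual (Disj.pair hFC) hv
    (fun i s => if tab v 1 true ≤ tab v i s then 0 else 1) ?_ ?_ ?_
  · intro i s j t h
    split_ifs <;> simp
    omega
  · intro c
    refine (infinite_part hC hpart (if c = 0 then true else false)).mono ?_
    rintro a ⟨ha, hs⟩
    refine ⟨1, ha, ?_⟩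
    change (if tab v 1 true ≤ tab v 1 (C.part a) then _ else _) = _
    rw [hs]
    fin_cases c <;> simp [hlt]
  · intro i a _
    refine finite_of_bound hE hF hC (fun j b => _ ∧ _ < loc ![F, C] (tab v) j b)
      (-(![F, C] i).key a).toNat ?_
    rintro b hb ⟨h1, h2⟩
    change (if tab v 1 true ≤ tab v 1 (C.part b) then (0 : Fin 2) else 1) = _ at h1
    replace h2 := Prod.Lex.lt_iff.1 h2
    change tab v i ((![F, C] i).part a) < tab v 1 (C.part b) ∨
      tab v i ((![F, C] i).part a) = tab v 1 (C.part b) ∧ (![F, C] i).key a < C.key b at h2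
    rw [hkey b hb] at h2
    have := hfirst i ((![F, C] i).part a)
    cases hs : C.part b <;> rw [hs] at h1 h2
    · omega
    · split_ifs at h1 <;> omega

end grow

/-- Any comparison between elements enumerated from two blocks gets decided by enlarging
the second block, provided it reaches one of the ends of the layout. -/
theorem exists_decided {Γ : EnumOp} (hΓ : Γ.TwoToThree) {E F : Block} (hE : E.Proper)
    (hF : F.dom.Finite) (hFE : Disjoint F.dom E.dom) {v : Fin 2 → ℕ × ℕ} (hv : PInj (tab v))
    (hlt : tab v 1 false < tab v 1 true)
    (hend : (∀ i s, tab v i s ≤ tab v 1 true) ∨ ∀ i s, tab v 1 false ≤ tab v i s)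
    {M : Set ℕ} (hM : M.Finite) {x y : ℕ}
    (hx : x ∈ Γ.memD (two F E v)) (hy : y ∈ Γ.memD (two F E v)) (hxy : x ≠ y) :
    ∃ E' : Block, E.Le E' ∧ E'.Proper ∧ Disjoint E'.dom (M \ E.dom) ∧
      ((x, y) ∈ Γ.posD (two F E' v) ∨ (y, x) ∈ Γ.posD (two F E' v)) := by
  obtain ⟨G, hG⟩ := ((hE.fin.union hF).union hM).bddAbove
  have hEG : ∀ a ∈ E.dom, a < G + 1 := fun a ha => Nat.lt_succ_of_le (hG (Or.inl (Or.inl ha)))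
  have hFG : ∀ a ∈ F.dom, a < G + 1 := fun a ha => Nat.lt_succ_of_le (hG (Or.inl (Or.inr ha)))
  have hMG : ∀ a ∈ M, a < G + 1 := fun a ha => Nat.lt_succ_of_le (hG (Or.inr ha))
  have done : ∀ E' : Block, E'.dom ⊆ E.dom ∪ Ici (G + 1) → Disjoint E'.dom (M \ E.dom) :=
    fun E' h => disjoint_left.2 fun a ha ha' =>
      (h ha).elim ha'.2 fun h => (hMG a ha'.1).not_ge h
  have hFC : Disjoint F.dom (E.dom ∪ Ici (G + 1)) :=
    disjoint_union_right.2 ⟨hFE, disjoint_left.2 fun a ha ha' => (hFG a ha).not_ge ha'⟩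
  rcases hend with hend | hend
  · obtain ⟨C, K, hEC, hC, hpart, hkey⟩ := exists_grow E hE.fin _ hEG true
    have := hΓ.1 _ (isCopy_grow_right hE.fin hF (by rwa [hC]) hC hpart hkey hv hlt hend)
    obtain ⟨E', h1, h2, h3, h4⟩ :=
      exists_decided_of_outCopy hE hFG hFE hEC hC this hx hy hxy
    exact ⟨E', h1, h2, done E' h3, h4⟩
  · obtain ⟨C, K, hEC, hC, hpart, hkey⟩ := exists_grow E hE.fin _ hEG false
    have := hΓ.2 _ (isCopy_grow_left hE.fin hF (by rwa [hC]) hC hpart hkey hv hlt hend)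
    obtain ⟨E', h1, h2, h3, h4⟩ :=
      exists_decided_of_outCopy hE hFG hFE hEC hC this hx hy hxy
    exact ⟨E', h1, h2, done E' h3, h4⟩

/-- A single block. -/
def solo (E : Block) : LinDiag := lay (fun _ : Unit => E) fun _ s => s

theorem solo_sub {E F : Block} (h : E.Le F) : (solo E).Sub (solo F) :=
  lay_sub (fun _ _ _ _ _ => rfl) id (fun _ => h) fun _ _ _ _ => Iff.rfl

theorem solo_sub_lay {κ Q : Type} [LinearOrder Q] {C : κ → Block} (hC : Disj C)
    {p : κ → Bool → Q} (k : κ) (hp : p k false < p k true) : (solo (C k)).Sub (lay C p) := by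
  refine lay_sub hC (fun _ => k) (fun _ => Le.refl _) ?_
  intro i s j t
  change s < t ↔ p k s < p k t
  have : ¬ true < false := by decide
  cases s <;> cases t <;> simp [hp, hp.not_gt, this]

/-- The interleaved layout of two blocks. -/
def inter : Fin 2 → ℕ × ℕ := ![(0, 2), (1, 3)]

/-- Far away labels produce far away elements between `z 0` and `z 1` and between
`z 1` and `z 2`. -/
def SuppliesAbove (Γ : EnumOp) (E : Block) (z : Fin 3 → ℕ) (G : ℕ) : Prop :=
  ∃ S : Block, S.Proper ∧ S.dom ⊆ Ici G ∧ ∃ w : Fin 2 → ℕ, ∀ c, G ≤ w c ∧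
    w c ∈ Γ.memD (two E S inter) ∧ (z c.castSucc, w c) ∈ Γ.posD (two E S inter) ∧
      (w c, z c.succ) ∈ Γ.posD (two E S inter)

/-- `SuppliesAbove` for every bound. -/
def Supplies (Γ : EnumOp) (E : Block) (z : Fin 3 → ℕ) : Prop := ∀ G, SuppliesAbove Γ E z G

theorem SuppliesAbove.anti {Γ : EnumOp} {E : Block} {z : Fin 3 → ℕ} {G G' : ℕ}
    (h : SuppliesAbove Γ E z G') (hG : G ≤ G') : SuppliesAbove Γ E z G := by
  obtain ⟨S, hS, hd, w, hw⟩ := h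
  exact ⟨S, hS, hd.trans (Ici_subset_Ici.2 hG), w, fun c => ⟨hG.trans (hw c).1, (hw c).2⟩⟩

theorem Supplies.mono {Γ : EnumOp} {E F : Block} {z : Fin 3 → ℕ} (h : Supplies Γ E z)
    (hEF : E.Le F) (hF : F.dom.Finite) : Supplies Γ F z := by
  intro G
  obtain ⟨K, hK⟩ := hF.bddAbove
  obtain ⟨S, hS, hd, w, hw⟩ := (h (max G (K + 1)))
  have hs := two_sub hEF (Le.refl S) (disjoint_left.2 fun a ha ha' => by
    have h1 := hK ha
    have h2 := (le_max_right _ _).trans (mem_Ici.1 (hd ha'))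
    omega) inter
  exact ⟨S, hS, fun a ha => (le_max_left _ _).trans (mem_Ici.1 (hd ha)), w, fun c =>
    ⟨(le_max_left _ _).trans (hw c).1, hs.memD Γ (hw c).2.1, hs.posD Γ (hw c).2.2.1,
      hs.posD Γ (hw c).2.2.2⟩⟩

/-- The block in which even labels are below and odd labels are above. -/
def std (D : Set ℕ) : Block where
  dom := D
  part a := decide (a % 2 = 1)
  key a := a
  inj a _ b _ _ h := by exact_mod_cast h

theorem std_le {D D' : Set ℕ} (h : D ⊆ D') : (std D).Le (std D') :=
  ⟨h, fun _ _ => rfl, fun _ _ => rfl⟩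

theorem isCopy_std {D : Set ℕ} (h : ∀ s, {a | a ∈ D ∧ decide (a % 2 = 1) = s}.Infinite) :
    IsCopy (Lex (Fin 2 × ℕ)) (solo (std D)) := by
  refine isCopy_lay (fun _ _ _ _ _ => rfl) (fun _ _ _ _ h => ⟨rfl, h⟩)
    (fun _ s => if s then 1 else 0) ?_ ?_ ?_
  · rintro - s - t h
    revert h
    cases s <;> cases t <;> decide
  · intro c
    refine (h (if c = 0 then false else true)).mono ?_
    rintro a ⟨ha, hs⟩
    refine ⟨(), ha, ?_⟩
    change (if decide (a % 2 = 1) = true then (1 : Fin 2) else 0) = c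
    rw [hs]
    fin_cases c <;> simp
  · rintro - a -
    refine (finite_Iic a).subset ?_
    rintro b ⟨_, _, h1, h2⟩
    replace h2 := Prod.Lex.lt_iff.1 h2
    change decide (b % 2 = 1) < decide (a % 2 = 1) ∨
      decide (b % 2 = 1) = decide (a % 2 = 1) ∧ (b : ℤ) < a at h2
    change (if decide (b % 2 = 1) = true then (1 : Fin 2) else 0) =
      if decide (a % 2 = 1) = true then 1 else 0 at h1
    rcases h2 with h2 | h2
    · have := Bool.lt_iff.1 h2
      rw [this.1, this.2] at h1
      simp at h1
    · exact_mod_cast h2.2.le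

theorem two_sub_solo {D D₁ D₂ : Set ℕ} (h₁ : D₁ ⊆ D) (h₂ : D₂ ⊆ D)
    (h : ∀ a ∈ D₁, ∀ b ∈ D₂, a < b) : (two (std D₁) (std D₂) inter).Sub (solo (std D)) := by
  have hdj : Disjoint (std D₁).dom (std D₂).dom :=
    disjoint_left.2 fun a ha hb => lt_irrefl _ (h a ha a hb)
  have hd : ∀ i, (![std D₁, std D₂] i).dom ⊆ D := by
    intro i; fin_cases i; exacts [h₁, h₂]
  have hdom : (two (std D₁) (std D₂) inter).dom ⊆ (solo (std D)).dom := by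
    intro a ha
    obtain ⟨i, hi⟩ := mem_iUnion.1 ha
    exact mem_iUnion.2 ⟨(), hd i hi⟩
  refine ⟨hdom, fun a ha b hb => ?_⟩
  obtain ⟨i, hi⟩ := mem_iUnion.1 ha
  obtain ⟨j, hj⟩ := mem_iUnion.1 hb
  rw [two, lay_rel (Disj.pair hdj) _ hi hj, solo,
    lay_rel (fun _ _ _ _ _ => rfl) _ (i := ()) (j := ()) (hd i hi) (hd j hj)]
  simp only [loc, Prod.Lex.toLex_lt_toLex]
  fin_cases i <;> fin_cases j
  · change tab inter 0 (decide (a % 2 = 1)) < tab inter 0 (decide (b % 2 = 1)) ∨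
      tab inter 0 (decide (a % 2 = 1)) = tab inter 0 (decide (b % 2 = 1)) ∧ (a : ℤ) < b ↔
      decide (a % 2 = 1) < decide (b % 2 = 1) ∨
      decide (a % 2 = 1) = decide (b % 2 = 1) ∧ (a : ℤ) < b
    generalize decide (a % 2 = 1) = s
    generalize decide (b % 2 = 1) = t
    cases s <;> cases t <;> simp [tab, inter]
  · have hab : (a : ℤ) < b := by exact_mod_cast h a hi b hj
    change tab inter 0 (decide (a % 2 = 1)) < tab inter 1 (decide (b % 2 = 1)) ∨
      tab inter 0 (decide (a % 2 = 1)) = tab inter 1 (decide (b % 2 = 1)) ∧ (a : ℤ) < b ↔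
      decide (a % 2 = 1) < decide (b % 2 = 1) ∨
      decide (a % 2 = 1) = decide (b % 2 = 1) ∧ (a : ℤ) < b
    generalize decide (a % 2 = 1) = s
    generalize decide (b % 2 = 1) = t
    cases s <;> cases t <;> simp [tab, inter, hab]
  · have hab : ¬ (a : ℤ) < b := by exact_mod_cast (h b hj a hi).not_gt
    change tab inter 1 (decide (a % 2 = 1)) < tab inter 0 (decide (b % 2 = 1)) ∨
      tab inter 1 (decide (a % 2 = 1)) = tab inter 0 (decide (b % 2 = 1)) ∧ (a : ℤ) < b ↔
      decide (a % 2 = 1) < decide (b % 2 = 1) ∨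
      decide (a % 2 = 1) = decide (b % 2 = 1) ∧ (a : ℤ) < b
    generalize decide (a % 2 = 1) = s
    generalize decide (b % 2 = 1) = t
    cases s <;> cases t <;> simp [tab, inter, hab]
  · change tab inter 1 (decide (a % 2 = 1)) < tab inter 1 (decide (b % 2 = 1)) ∨
      tab inter 1 (decide (a % 2 = 1)) = tab inter 1 (decide (b % 2 = 1)) ∧ (a : ℤ) < b ↔
      decide (a % 2 = 1) < decide (b % 2 = 1) ∨
      decide (a % 2 = 1) = decide (b % 2 = 1) ∧ (a : ℤ) < b
    generalize decide (a % 2 = 1) = s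
    generalize decide (b % 2 = 1) = t
    cases s <;> cases t <;> simp [tab, inter]

/-- A bound above which a failure to supply is visible, uniform over small parameters. -/
theorem exists_supply_bound (Γ : EnumOp) (N : ℕ) : ∃ G, ∀ D : Finset ℕ, (∀ a ∈ D, a < N) →
    ∀ z : Fin 3 → ℕ, (∀ c, z c < N) → SuppliesAbove Γ (std D) z G → Supplies Γ (std D) z := by
  classical
  have h : ∀ (D : Finset ℕ) (z : Fin 3 → ℕ), ∃ G, SuppliesAbove Γ (std D) z G →
      Supplies Γ (std D) z := by
    intro D z
    by_contra! h
    exact (h 0).2 fun G => (h G).1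
  choose G hG using h
  let X := (Finset.range N).powerset ×ˢ Fintype.piFinset fun _ : Fin 3 => Finset.range N
  refine ⟨X.sup fun x => G x.1 x.2, fun D hD z hz hs => hG D z (hs.anti ?_)⟩
  refine Finset.le_sup (f := fun x : Finset ℕ × (Fin 3 → ℕ) => G x.1 x.2) (b := (D, z)) ?_
  simp only [X, Finset.mem_product, Finset.mem_powerset, Fintype.mem_piFinset, Finset.mem_range]
  exact ⟨fun a ha => Finset.mem_range.2 (hD a ha), hz⟩

theorem exists_supplies {Γ : EnumOp} (hΓ : Γ.TwoToThree) (M₀ : ℕ) :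
    ∃ (E : Block) (z : Fin 3 → ℕ), E.Proper ∧ E.dom ⊆ Ici M₀ ∧ (∀ c, M₀ ≤ z c) ∧
      (∀ c, z c ∈ Γ.memD (solo E)) ∧ Supplies Γ E z := by
  classical
  choose gr hgr using exists_supply_bound Γ
  obtain ⟨v, hv0, hvlt, hvgr⟩ : ∃ v : ℕ → ℕ, M₀ ≤ v 0 ∧ (∀ i, v i < v (i + 1)) ∧
      ∀ i, gr (2 * v i + 2) ≤ v (i + 1) :=
    ⟨fun n => n.rec M₀ fun _ x => max (x + 1) (gr (2 * x + 2)), le_rfl,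
      fun _ => Nat.lt_of_succ_le (le_max_left _ _), fun _ => le_max_right _ _⟩
  have hmono : StrictMono v := strictMono_nat_of_lt_succ hvlt
  have hge : ∀ i, i ≤ v i := fun i => hmono.le_apply
  let C : Set ℕ := {a | ∃ i, a / 2 = v i}
  have hcopy := hΓ.1 _ (isCopy_std (D := C) fun s => by
    refine (infinite_range_of_injective (f := fun n => 2 * v n + if s then 1 else 0)
      fun a b h => hmono.injective (by simpa using h)).mono ?_
    rintro _ ⟨n, rfl⟩
    refine ⟨⟨n, ?_⟩, ?_⟩
    · cases s <;> simp
      omega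
    · cases s <;> simp)
  obtain ⟨g, gi, gr', gp, -⟩ := hcopy
  have hpick : ∀ (c : Fin 3) (m N : ℕ), ∃ k, m < k ∧ N ≤ g (toLex (c, k)) := by
    intro c m N
    have hinj : Function.Injective fun k => g (toLex (c, k)) := fun a b h => by
      simpa using gi h
    obtain ⟨x, ⟨k, hk, rfl⟩, hx⟩ := ((Ioi_infinite m).image hinj.injOn).exists_gt N
    exact ⟨k, hk, hx.le⟩
  choose k _ hkM using fun c => hpick c 0 M₀
  let z : Fin 3 → ℕ := fun c => g (toLex (c, k c))
  have hz : ∀ c, z c ∈ Γ.memD (solo (std C)) := fun c => by rw [gr']; exact mem_range_self _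
  choose α hα hzα using hz
  obtain ⟨n, hn⟩ : ∃ n : ℕ, ∀ c, z c ≤ n ∧ ∀ a ∈ (α c).dom, a ≤ n := by
    refine ⟨∑ c, (z c + ∑ a ∈ (α c).dom, a), fun c => ?_⟩
    have h1 := Finset.single_le_sum (f := fun c => z c + ∑ a ∈ (α c).dom, a)
      (fun _ _ => Nat.zero_le _) (Finset.mem_univ c)
    refine ⟨(Nat.le_add_right _ _).trans h1, fun a ha => ?_⟩
    have h2 := Finset.single_le_sum (f := fun a : ℕ => a) (fun _ _ => Nat.zero_le _) ha
    exact (h2.trans (Nat.le_add_left _ _)).trans h1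
  have hvn := hge n
  let D : Finset ℕ := (Finset.range (2 * v n + 2)).filter (· ∈ C)
  have hD : ∀ a, a ∈ D ↔ a < 2 * v n + 2 ∧ a ∈ C := by simp [D]
  have hDC : (D : Set ℕ) ⊆ C := fun a ha => ((hD a).1 ha).2
  have hfar : ∀ a ∈ C, 2 * v n + 2 ≤ a → 2 * v (n + 1) ≤ a := by
    rintro a ⟨i, hi⟩ ha
    have : v n < v i := by omega
    have := hmono.monotone (Nat.succ_le_of_lt (hmono.lt_iff_lt.1 this))
    simp only [Nat.succ_eq_add_one] at this
    omega
  refine ⟨std D, z, ⟨D.finite_toSet, fun s => ?_⟩, fun a ha => ?_, hkM, fun c => ?_, ?_⟩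
  · refine ⟨2 * v n + if s then 1 else 0, (hD _).2 ⟨?_, n, ?_⟩, ?_⟩
    · split_ifs <;> omega
    · split_ifs <;> omega
    · cases s <;> simp [std]
  · obtain ⟨i, hi⟩ := hDC ha
    have := hmono.monotone (Nat.zero_le i)
    rw [mem_Ici]
    omega
  · refine ⟨α c, (hα c).of_sub (solo_sub (std_le hDC)) fun a ha => ?_, hzα c⟩
    obtain ⟨_, hi⟩ := mem_iUnion.1 ((hα c).1 ha)
    have := (hn c).2 a ha
    exact mem_iUnion.2 ⟨(), (hD a).2 ⟨by omega, hi⟩⟩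
  · refine hgr (2 * v n + 2) D (fun a ha => ((hD a).1 ha).1) z
      (fun c => by have := (hn c).1; omega) ?_
    choose k' hk' hkG using fun c : Fin 2 => hpick c.castSucc (k c.castSucc) (gr (2 * v n + 2))
    let w : Fin 2 → ℕ := fun c => g (toLex (c.castSucc, k' c))
    have hw : ∀ c, w c ∈ Γ.memD (solo (std C)) := fun c => by rw [gr']; exact mem_range_self _
    have hw1 : ∀ c, (z c.castSucc, w c) ∈ Γ.posD (solo (std C)) := fun c =>
      (gp _ _).2 (Prod.Lex.toLex_lt_toLex.2 (Or.inr ⟨rfl, hk' c⟩))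
    have hw2 : ∀ c, (w c, z c.succ) ∈ Γ.posD (solo (std C)) := fun c =>
      (gp _ _).2 (Prod.Lex.toLex_lt_toLex.2 (Or.inl (Fin.castSucc_lt_succ)))
    choose β hβ hwβ using hw
    choose β₁ hβ₁ hwβ₁ using hw1
    choose β₂ hβ₂ hwβ₂ using hw2
    let A : Finset ℕ := Finset.univ.biUnion fun c => (β c).dom ∪ (β₁ c).dom ∪ (β₂ c).dom
    obtain ⟨m, hm⟩ := A.bddAbove
    have hA : ∀ c, ∀ a, a ∈ (β c).dom ∨ a ∈ (β₁ c).dom ∨ a ∈ (β₂ c).dom → a ≤ m := by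
      intro c a ha
      refine hm (Finset.mem_coe.2 (Finset.mem_biUnion.2 ⟨c, Finset.mem_univ c, ?_⟩))
      simp only [Finset.mem_union]
      tauto
    let T : Set ℕ := {a | a ∈ C ∧ 2 * v n + 2 ≤ a ∧ a ≤ m + 2 * v (n + 1) + 1}
    have hTC : T ⊆ C := fun a ha => ha.1
    have hsub := two_sub_solo hDC hTC fun a ha b hb => ((hD a).1 ha).1.trans_le hb.2.1
    have hdom : ∀ γ : FinLO, γ.SubDiag (solo (std C)) → (∀ a ∈ γ.dom, a ≤ m) →
        γ.SubDiag (two (std D) (std T) inter) := by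
      refine fun γ hγ hm => hγ.of_sub hsub fun a ha => ?_
      obtain ⟨_, hi⟩ := mem_iUnion.1 (hγ.1 ha)
      have := hm a ha
      rcases lt_or_ge a (2 * v n + 2) with h | h
      · exact mem_iUnion.2 ⟨0, (hD a).2 ⟨h, hi⟩⟩
      · exact mem_iUnion.2 ⟨1, hi, h, by omega⟩
    have := hvlt n
    refine ⟨std T, ⟨(finite_Iic _).subset fun a ha => ha.2.2, fun s => ?_⟩, fun a ha => ?_, w,
      fun c => ⟨hkG c, ⟨β c, hdom _ (hβ c) fun a ha => hA c a (Or.inl ha), hwβ c⟩,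
        ⟨β₁ c, hdom _ (hβ₁ c) fun a ha => hA c a (Or.inr (Or.inl ha)), hwβ₁ c⟩,
        ⟨β₂ c, hdom _ (hβ₂ c) fun a ha => hA c a (Or.inr (Or.inr ha)), hwβ₂ c⟩⟩⟩
    · refine ⟨2 * v (n + 1) + if s then 1 else 0, ⟨⟨n + 1, ?_⟩, ?_, ?_⟩, ?_⟩
      · split_ifs <;> omega
      · split_ifs <;> omega
      · split_ifs <;> omega
      · cases s <;> simp [std]
    · have h1 := hvgr n
      have h2 := hfar a ha.1 ha.2.1
      rw [mem_Ici]
      omega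

end Block

theorem exists_homogeneous {K : Type} [Finite K] (c : ℕ → ℕ → K) :
    ∃ (k : K) (f : ℕ → ℕ), ∀ m n, m < n → f m < f n ∧ c (f m) (f n) = k := by
  have h : ∀ i, ∃ k, ∀ᶠ j in (Filter.hyperfilter ℕ : Filter ℕ), c i j = k := fun i =>
    Ultrafilter.eventually_exists_iff.1 (Filter.Eventually.of_forall fun j => ⟨c i j, rfl⟩)
  choose κ hκ using h
  obtain ⟨k, hk⟩ : ∃ k, ∀ᶠ i in (Filter.hyperfilter ℕ : Filter ℕ), κ i = k :=
    Ultrafilter.eventually_exists_iff.1 (Filter.Eventually.of_forall fun j => ⟨κ j, rfl⟩)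
  obtain ⟨f, -, hf⟩ := exists_seq_of_forall_finset_exists (fun i => κ i = k)
    (fun i j => i < j ∧ c i j = k) fun s hs => by
      have h1 : ∀ᶠ j in (Filter.hyperfilter ℕ : Filter ℕ), ∀ i ∈ s, i < j ∧ c i j = k := by
        rw [Filter.eventually_all_finset]
        intro i hi
        have h2 := hκ i
        rw [hs i hi] at h2
        have h3 : ∀ᶠ j in (Filter.hyperfilter ℕ : Filter ℕ), i < j :=
          Nat.hyperfilter_le_atTop (Filter.eventually_gt_atTop i)
        exact h3.and h2
      exact (hk.and h1).exists
  exact ⟨k, f, fun m n h => hf m n h⟩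

namespace Block

/-- The five layouts of an old block (index `0`) and a new block (index `1`). -/
def pat : Fin 5 → Fin 2 → ℕ × ℕ :=
  ![inter, ![(1, 3), (0, 2)], ![(1, 2), (0, 3)], ![(0, 1), (2, 3)], ![(2, 3), (0, 1)]]

theorem pInj_pat : ∀ e, PInj (tab (pat e)) := by unfold PInj; decide

theorem pat_lt : ∀ e i, tab (pat e) i false < tab (pat e) i true := by decide

theorem pat_end : ∀ e, (∀ i s, tab (pat e) i s ≤ tab (pat e) 1 true) ∨
    ∀ i s, tab (pat e) 1 false ≤ tab (pat e) i s := by decide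

/-- A block with three marked elements that it enumerates and supplies. -/
structure Marked (Γ : EnumOp) (x : Block × (Fin 3 → ℕ)) : Prop where
  proper : x.1.Proper
  mem : ∀ c, x.2 c ∈ Γ.memD (solo x.1)
  supplies : Supplies Γ x.1 x.2

/-- All marked elements of the two blocks are compared in each of the five layouts. -/
structure Decided (Γ : EnumOp) (x y : Block × (Fin 3 → ℕ)) : Prop where
  disj : Disjoint x.1.dom y.1.dom
  ne : ∀ a b, x.2 a ≠ y.2 b
  dec : ∀ e a b, (x.2 a, y.2 b) ∈ Γ.posD (two x.1 y.1 (pat e)) ∨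
    (y.2 b, x.2 a) ∈ Γ.posD (two x.1 y.1 (pat e))

theorem exists_decided_finset {Γ : EnumOp} (hΓ : Γ.TwoToThree)
    (s : Finset (Block × (Fin 3 → ℕ))) (hs : ∀ x ∈ s, Marked Γ x) :
    ∃ y, Marked Γ y ∧ ∀ x ∈ s, Decided Γ x y := by
  classical
  have hM : (⋃ x ∈ s, x.1.dom).Finite :=
    s.finite_toSet.biUnion fun x hx => (hs x hx).proper.fin
  have hN : (⋃ x ∈ s, range x.2).Finite := s.finite_toSet.biUnion fun x _ => finite_range _
  obtain ⟨M₀, hM₀⟩ := (hM.union hN).bddAbove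
  obtain ⟨E₀, z, hE₀, hfar, hz, hmem, hsup⟩ := exists_supplies hΓ (M₀ + 1)
  have hne : ∀ x ∈ s, ∀ a b, x.2 a ≠ z b := by
    intro x hx a b h
    have h1 := hM₀ (Or.inr (mem_biUnion hx (mem_range_self a)))
    have h2 := hz b
    omega
  have hdj : Disjoint E₀.dom (⋃ x ∈ s, x.1.dom) := disjoint_left.2 fun a ha ha' => by
    have h1 := hM₀ (Or.inl ha')
    have h2 := mem_Ici.1 (hfar ha)
    omega
  have hof : ∀ E : Block, Disjoint E.dom (⋃ x ∈ s, x.1.dom) → ∀ x ∈ s,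
      Disjoint x.1.dom E.dom := fun E h x hx =>
    (h.mono_right (subset_biUnion_of_mem (u := fun x : Block × (Fin 3 → ℕ) => x.1.dom) hx)).symm
  have key : ∀ T : Finset ((Block × (Fin 3 → ℕ)) × Fin 5 × Fin 3 × Fin 3), (∀ t ∈ T, t.1 ∈ s) →
      ∃ E, E₀.Le E ∧ E.Proper ∧ Disjoint E.dom (⋃ x ∈ s, x.1.dom) ∧
        ∀ t ∈ T, (t.1.2 t.2.2.1, z t.2.2.2) ∈ Γ.posD (two t.1.1 E (pat t.2.1)) ∨
          (z t.2.2.2, t.1.2 t.2.2.1) ∈ Γ.posD (two t.1.1 E (pat t.2.1)) := by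
    intro T
    induction T using Finset.induction_on with
    | empty => exact fun _ => ⟨E₀, Le.refl _, hE₀, hdj, by simp⟩
    | insert t T _ ih =>
      intro hT
      obtain ⟨E, h1, h2, h3, h4⟩ := ih fun t ht => hT t (Finset.mem_insert_of_mem ht)
      obtain ⟨x, e, a, b⟩ := t
      have hx : x ∈ s := hT _ (Finset.mem_insert_self _ _)
      have hxE := hof E h3 x hx
      have m0 := (solo_sub_lay (Disj.pair hxE) 0 (pat_lt e 0)).memD Γ ((hs x hx).mem a)
      have m1 := (solo_sub_lay (Disj.pair hxE) 1 (pat_lt e 1)).memD Γ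
        ((solo_sub h1).memD Γ (hmem b))
      obtain ⟨E', h5, h6, h7, h8⟩ := exists_decided hΓ h2 (hs x hx).proper.fin hxE (pInj_pat e)
        (pat_lt e 1) (pat_end e) hM m0 m1 (hne x hx a b)
      have h9 : Disjoint E'.dom (⋃ x ∈ s, x.1.dom) := by
        rwa [(h3.symm.sdiff_eq_left : (⋃ x ∈ s, x.1.dom) \ E.dom = _)] at h7
      refine ⟨E', h1.trans h5, h6, h9, fun t ht => ?_⟩
      rcases Finset.mem_insert.1 ht with rfl | ht'
      · exact h8
      · have hsub := two_sub (Le.refl t.1.1) h5 (hof E' h9 t.1 (hT t ht)) (pat t.2.1)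
        exact (h4 t ht').imp (fun h => hsub.posD Γ h) fun h => hsub.posD Γ h
  obtain ⟨E, h1, h2, h3, h4⟩ := key (s ×ˢ Finset.univ) fun t ht => (Finset.mem_product.1 ht).1
  exact ⟨(E, z), ⟨h2, fun c => (solo_sub h1).memD Γ (hmem c), hsup.mono h1 h2.fin⟩,
    fun x hx => ⟨hof E h3 x hx, hne x hx, fun e a b =>
      h4 (x, e, a, b) (Finset.mem_product.2 ⟨hx, Finset.mem_univ _⟩)⟩⟩

/-- A sequence of marked blocks in which the comparisons between marked elements of two
blocks only depend on which of the blocks comes first. -/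
structure Homog (Γ : EnumOp) where
  E : ℕ → Block
  z : ℕ → Fin 3 → ℕ
  c : Fin 5 → Fin 3 → Fin 3 → Prop
  marked : ∀ i, Marked Γ (E i, z i)
  disj : Disj E
  ne : ∀ i j, i < j → ∀ a b, z i a ≠ z j b
  pos : ∀ i j, i < j → ∀ e a b, c e a b → (z i a, z j b) ∈ Γ.posD (two (E i) (E j) (pat e))
  neg : ∀ i j, i < j → ∀ e a b, ¬ c e a b → (z j b, z i a) ∈ Γ.posD (two (E i) (E j) (pat e))

theorem nonempty_homog {Γ : EnumOp} (hΓ : Γ.TwoToThree) : Nonempty (Homog Γ) := by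
  obtain ⟨x, hx, hr⟩ := exists_seq_of_forall_finset_exists (Marked Γ) (Decided Γ)
    (exists_decided_finset hΓ)
  obtain ⟨k, f, hf⟩ := exists_homogeneous fun i j => fun (e : Fin 5) (a b : Fin 3) =>
    ((x i).2 a, (x j).2 b) ∈ Γ.posD (two (x i).1 (x j).1 (pat e))
  refine ⟨⟨fun i => (x (f i)).1, fun i => (x (f i)).2, k, fun i => hx _, fun i j a hi hj => ?_,
    fun i j h => (hr _ _ (hf i j h).1).ne, fun i j h e a b hk => ?_, fun i j h e a b hk => ?_⟩⟩
  · rcases lt_trichotomy i j with h | h | h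
    · exact absurd hj (disjoint_left.1 (hr _ _ (hf i j h).1).disj hi)
    · exact h
    · exact absurd hi (disjoint_left.1 (hr _ _ (hf j i h).1).disj hj)
  · rw [← (hf i j h).2] at hk
    exact hk
  · rw [← (hf i j h).2] at hk
    exact ((hr _ _ (hf i j h).1).dec e a b).resolve_left hk

end Block

theorem fst_lt_of_infinite_between {u v : Lex (Fin 3 × ℕ)} {S : Set (Lex (Fin 3 × ℕ))}
    (hS : S.Infinite) (h : ∀ q ∈ S, u < q ∧ q < v) : (ofLex u).1 < (ofLex v).1 := by
  by_contra hn
  refine hS (((finite_Iio (ofLex v).2).image fun m => toLex ((ofLex v).1, m)).subset ?_)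
  intro q hq
  obtain ⟨h1, h2⟩ := h q hq
  rw [Prod.Lex.lt_iff] at h1 h2
  have h3 : (ofLex u).1 ≤ (ofLex q).1 := h1.elim le_of_lt fun h => h.1.le
  rcases h2 with h2 | h2
  · exact absurd (h3.trans_lt h2) hn
  · exact ⟨(ofLex q).2, h2.2, by rw [← h2.1]; rfl⟩

theorem EnumOp.fst_rank_lt {Γ : EnumOp} {L : LinDiag} {b : ℕ → Lex (Fin 3 × ℕ)}
    (hb : InjOn b (Γ.memD L)) {x y : ℕ} {w : ℕ → ℕ} (hw : ∀ n, w n ∈ Γ.memD L)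
    (hinj : Function.Injective w) (h : ∀ n, b x < b (w n) ∧ b (w n) < b y) :
    (ofLex (b x)).1 < (ofLex (b y)).1 := by
  refine fst_lt_of_infinite_between (S := range fun n => b (w n)) (infinite_range_of_injective
    fun m n hmn => hinj (hb (hw m) (hw n) hmn)) ?_
  rintro _ ⟨n, rfl⟩
  exact h n

namespace Block

theorem two_sub_lay {κ Q : Type} [LinearOrder Q] {C : κ → Block} (hC : Disj C)
    {p : κ → Bool → Q} (v : Fin 2 → ℕ × ℕ) (k l : κ)
    (hp : ∀ i s j t, tab v i s < tab v j t ↔ p (![k, l] i) s < p (![k, l] j) t) :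
    (two (C k) (C l) v).Sub (lay C p) := by
  refine lay_sub hC ![k, l] (fun i => ?_) hp
  fin_cases i <;> exact Le.refl _

theorem inter_iff_split {k l : ℕ} (h : k < l) (i : Fin 2) (s : Bool) (j : Fin 2) (t : Bool) :
    tab inter i s < tab inter j t ↔ split (![k, l] i) s < split (![k, l] j) t := by
  have := h.not_gt
  fin_cases i <;> fin_cases j <;> cases s <;> cases t <;>
    simp [tab, inter, split, Prod.Lex.toLex_lt_toLex, h, this]

/-- A sequence of blocks, with elements lying between the marked elements of two given
blocks alternatingly. -/
theorem exists_supply_sequence {Γ : EnumOp} {F : Fin 2 → Block} {y : Fin 2 → Fin 3 → ℕ}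
    (hsup : ∀ k, Supplies Γ (F k) (y k)) (G₀ : ℕ) :
    ∃ (T : ℕ → Block) (w : ℕ → Fin 2 → ℕ), Disj T ∧ (∀ m, (T m).Proper) ∧
      (∀ m, (T m).dom ⊆ Ici G₀) ∧ (∀ c, Function.Injective fun m => w m c) ∧
      ∀ (k : Fin 2) (m c), w (2 * m + k) c ∈ Γ.memD (two (F k) (T (2 * m + k)) inter) ∧
        (y k c.castSucc, w (2 * m + k) c) ∈ Γ.posD (two (F k) (T (2 * m + k)) inter) ∧
        (w (2 * m + k) c, y k c.succ) ∈ Γ.posD (two (F k) (T (2 * m + k)) inter) := by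
  choose S hS hfar w hw using hsup
  have hbd : ∀ k G, ∃ G', G < G' ∧ (∀ a ∈ (S k G).dom, a < G') ∧ ∀ c, w k G c < G' := by
    intro k G
    obtain ⟨M, hM⟩ := ((hS k G).fin.union (finite_range (w k G))).bddAbove
    refine ⟨max G M + 1, by omega, fun a ha => ?_, fun c => ?_⟩
    · have := hM (Or.inl ha); omega
    · have := hM (Or.inr (mem_range_self c)); omega
  choose next h1 h2 h3 using hbd
  let κ : ℕ → Fin 2 := fun m => Fin.ofNat 2 m
  obtain ⟨G, hG0, hGs⟩ : ∃ G : ℕ → ℕ, G 0 = G₀ ∧ ∀ m, G (m + 1) = next (κ m) (G m) :=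
    ⟨fun n => n.rec G₀ fun m g => next (κ m) g, rfl, fun _ => rfl⟩
  have hGm : StrictMono G := strictMono_nat_of_lt_succ fun m => by rw [hGs]; exact h1 _ _
  have hT : ∀ m, ∀ a ∈ (S (κ m) (G m)).dom, G m ≤ a ∧ a < G (m + 1) := fun m a ha =>
    ⟨hfar _ _ ha, by rw [hGs]; exact h2 _ _ a ha⟩
  have hW : ∀ m c, G m ≤ w (κ m) (G m) c ∧ w (κ m) (G m) c < G (m + 1) := fun m c =>
    ⟨(hw _ _ c).1, by rw [hGs]; exact h3 _ _ c⟩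
  have huniq : ∀ a m n, G m ≤ a ∧ a < G (m + 1) → G n ≤ a ∧ a < G (n + 1) → m = n := by
    intro a m n hm hn
    have h4 := hGm.lt_iff_lt.1 (hm.1.trans_lt hn.2)
    have h5 := hGm.lt_iff_lt.1 (hn.1.trans_lt hm.2)
    omega
  have hκ : ∀ (k : Fin 2) m, κ (2 * m + k) = k := fun k m => by
    ext
    simp only [κ, Fin.ofNat]
    omega
  refine ⟨fun m => S (κ m) (G m), fun m => w (κ m) (G m), fun m n a hm hn =>
    huniq a m n (hT m a hm) (hT n a hn), fun m => hS _ _, fun m a ha => ?_,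
    fun c m n h => huniq _ m n (hW m c) (by beta_reduce at h; rw [h]; exact hW n c),
    fun k m c => ?_⟩
  · rw [mem_Ici, ← hG0]
    exact (hGm.monotone (Nat.zero_le m)).trans (hT m a ha).1
  · beta_reduce
    rw [hκ]
    exact (hw k _ c).2

/-- If the marked elements of two interleaved blocks are supplied, then each of them lies in
the component of the output given by its own index. -/
theorem not_posD_of_supplies {Γ : EnumOp} (hΓ : Γ.TwoToThree) {F : Fin 2 → Block}
    {y : Fin 2 → Fin 3 → ℕ} (hF : ∀ k, Marked Γ (F k, y k)) (hdj : Disjoint (F 0).dom (F 1).dom)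
    {a b : Fin 3} (hab : a < b) : (y 0 b, y 1 a) ∉ Γ.posD (two (F 0) (F 1) inter) := by
  intro hpos
  obtain ⟨M, hM⟩ := (finite_iUnion fun k => (hF k).proper.fin).bddAbove
  obtain ⟨T, w, hT, hTP, hTM, hwi, hw⟩ :=
    exists_supply_sequence (fun k => (hF k).supplies) (M + 1)
  let B : Fin 2 ⊕ ℕ → Block := Sum.elim F T
  let idx : Fin 2 ⊕ ℕ → ℕ := Sum.elim (fun k => k) fun m => m + 2
  have hidx : Function.Injective idx := by
    rintro (i | i) (j | j) h
    · exact congrArg _ (Fin.ext h)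
    · simp only [idx, Sum.elim_inl, Sum.elim_inr] at h; omega
    · simp only [idx, Sum.elim_inl, Sum.elim_inr] at h; omega
    · simpa [idx] using h
  have hsep : ∀ k m x, x ∈ (F k).dom → x ∉ (T m).dom := fun k m x hx hx' => by
    have h1 := hM (mem_iUnion.2 ⟨k, hx⟩)
    have h2 := mem_Ici.1 (hTM m hx')
    omega
  have hB : Disj B := by
    rintro (i | i) (j | j) x hi hj
    · fin_cases i <;> fin_cases j
      · rfl
      · exact absurd hj (disjoint_left.1 hdj hi)
      · exact absurd hi (disjoint_left.1 hdj hj)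
      · rfl
    · exact absurd hj (hsep i j x hi)
    · exact absurd hi (hsep j i x hj)
    · exact congrArg _ (hT i j x hi hj)
  have hcopy : IsCopy (Lex (Fin 2 × ℕ)) (lay B fun x => split (idx x)) := by
    refine isCopy_of_position hB ?_ (fun i s j t h => ?_) fun c => ?_
    · rintro (k | m)
      exacts [(hF k).proper, hTP m]
    · exact ⟨hidx (pInj_split _ _ _ _ h).1, (pInj_split _ _ _ _ h).2⟩
    · refine (infinite_range_of_injective Sum.inr_injective).mono ?_
      rintro _ ⟨m, rfl⟩
      fin_cases c
      exacts [⟨false, rfl⟩, ⟨true, rfl⟩]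
  have hmatch : ∀ x x', idx x < idx x' →
      (two (B x) (B x') inter).Sub (lay B fun x => split (idx x)) := by
    refine fun x x' h => two_sub_lay hB inter x x' fun i s j t => ?_
    rw [inter_iff_split h]
    fin_cases i <;> fin_cases j <;> rfl
  have hFT : ∀ (k : Fin 2) m,
      (two (F k) (T m) inter).Sub (lay B fun x => split (idx x)) := fun k m =>
    hmatch (Sum.inl k) (Sum.inr m) (by simp only [idx, Sum.elim_inl, Sum.elim_inr]; omega)
  obtain ⟨r, ri, rp⟩ := (hΓ.1 _ hcopy).exists_rank
  have hy : ∀ k c, y k c ∈ Γ.memD (lay B fun x => split (idx x)) := fun k c =>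
    (solo_sub_lay (C := B) hB (Sum.inl k) (by simp [split, Prod.Lex.toLex_lt_toLex])).memD Γ
      ((hF k).mem c)
  have hstep : ∀ k (c : Fin 2),
      (ofLex (r (y k c.castSucc))).1 < (ofLex (r (y k c.succ))).1 := by
    intro k c
    have hm : ∀ m, w (2 * m + k) c ∈ Γ.memD (lay B fun x => split (idx x)) := fun m =>
      (hFT k _).memD Γ (hw k m c).1
    refine EnumOp.fst_rank_lt ri hm (fun m n h => ?_) fun m => ⟨?_, ?_⟩
    · have := hwi c h
      omega
    · exact (rp _ (hy k _) _ (hm m)).1 ((hFT k _).posD Γ (hw k m c).2.1)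
    · exact (rp _ (hm m) _ (hy k _)).1 ((hFT k _).posD Γ (hw k m c).2.2)
  have hcomp : ∀ k c, (ofLex (r (y k c))).1 = c := by
    intro k c
    have h0 : (ofLex (r (y k 0))).1 < (ofLex (r (y k 1))).1 := hstep k 0
    have h1 : (ofLex (r (y k 1))).1 < (ofLex (r (y k 2))).1 := hstep k 1
    fin_cases c
    · change (ofLex (r (y k 0))).1 = 0
      omega
    · change (ofLex (r (y k 1))).1 = 1
      omega
    · change (ofLex (r (y k 2))).1 = 2
      omega
  have hlt := (rp _ (hy 0 b) _ (hy 1 a)).1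
    ((hmatch (Sum.inl 0) (Sum.inl 1) (by simp [idx])).posD Γ hpos)
  rw [Prod.Lex.lt_iff, hcomp, hcomp] at hlt
  rcases hlt with h | h
  · exact absurd h hab.not_gt
  · exact hab.ne' h.1

namespace Homog

variable {Γ : EnumOp} (H : Homog Γ)

theorem mem_lay {κ Q : Type} [LinearOrder Q] {f : κ → ℕ} (hf : Function.Injective f)
    {p : κ → Bool → Q} {k : κ} (hp : p k false < p k true) (a : Fin 3) :
    H.z (f k) a ∈ Γ.memD (lay (fun k => H.E (f k)) p) :=
  (solo_sub_lay (C := fun k => H.E (f k)) (fun _ _ x hi hj => hf (H.disj _ _ x hi hj)) k hp).memD Γ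
    ((H.marked (f k)).mem a)

theorem sub_lay {Q : Type} [LinearOrder Q] {p : ℕ → Bool → Q} (e : Fin 5) (i j : ℕ)
    (hp : ∀ k s l t, tab (pat e) k s < tab (pat e) l t ↔ p (![i, j] k) s < p (![i, j] l) t) :
    (two (H.E i) (H.E j) (pat e)).Sub (lay H.E p) :=
  two_sub_lay H.disj (pat e) i j hp

/-- The comparisons that hold in a finite configuration of blocks are consistent. -/
theorem exists_rank_of_table (hΓ : Γ.TwoToThree) {n : ℕ} (f : Fin n → ℕ)
    (hf : Function.Injective f) (v : Fin n → ℕ × ℕ) (hv : PInj (tab v))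
    (hb : ∀ i s, tab v i s < 8) :
    ∃ r : ℕ → Lex (Fin 3 × ℕ), ∀ (e : Fin 5) (k l : Fin n),
      (∀ i s j t, tab (pat e) i s < tab (pat e) j t ↔
        tab v (![k, l] i) s < tab v (![k, l] j) t) → f k < f l → ∀ a b,
      (H.c e a b → r (H.z (f k) a) < r (H.z (f l) b)) ∧
      (¬ H.c e a b → r (H.z (f l) b) < r (H.z (f k) a)) := by
  obtain ⟨L, hL, hsub⟩ := exists_copy_of_table H.disj (fun i => (H.marked i).proper) f hf v hv hb
  obtain ⟨r, -, hr⟩ := (hΓ.1 L hL).exists_rank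
  have hD : Disj fun k => H.E (f k) := fun i j x hi hj => hf (H.disj _ _ x hi hj)
  refine ⟨r, fun e k l hp hkl a b => ?_⟩
  have hs : (two (H.E (f k)) (H.E (f l)) (pat e)).Sub L :=
    (two_sub_lay hD (pat e) k l hp).trans hsub
  have hm : ∀ i : Fin 2, tab v (![k, l] i) false < tab v (![k, l] i) true := fun i =>
    (hp i false i true).1 (pat_lt e i)
  have hk := hsub.memD Γ (H.mem_lay hf (hm 0) a)
  have hl := hsub.memD Γ (H.mem_lay hf (hm 1) b)
  exact ⟨fun h => (hr _ hk _ hl).1 (hs.posD Γ (H.pos _ _ hkl e a b h)),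
    fun h => (hr _ hl _ hk).1 (hs.posD Γ (H.neg _ _ hkl e a b h))⟩

theorem interleaved (hΓ : Γ.TwoToThree) (a : Fin 3) : H.c 0 a a := by
  by_contra hc
  obtain ⟨r, -, hr⟩ := (hΓ.1 _ (isCopy_split H.disj fun i => (H.marked i).proper)).exists_rank
  have hm : ∀ i, H.z i a ∈ Γ.memD (lay H.E split) := fun i =>
    H.mem_lay Function.injective_id (p := split) (k := i)
      (by simp [split, Prod.Lex.toLex_lt_toLex]) a
  refine not_strictAnti_of_wellFoundedLT (fun i => r (H.z i a)) fun i j hij => ?_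
  exact (hr _ (hm j) _ (hm i)).1
    ((H.sub_lay 0 i j (inter_iff_split hij)).posD Γ (H.neg i j hij 0 a a hc))

theorem interleaved_dual (hΓ : Γ.TwoToThree) (a : Fin 3) : ¬ H.c 1 a a := by
  intro hc
  obtain ⟨r, -, hr⟩ :=
    (hΓ.2 _ (isCopy_split_dual H.disj fun i => (H.marked i).proper)).exists_rank
  have hm : ∀ i, H.z i a ∈ Γ.memD (lay H.E fun i s => OrderDual.toDual (split i !s)) := fun i =>
    H.mem_lay Function.injective_id (p := fun i s => OrderDual.toDual (split i !s)) (k := i)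
      (by simp [split, Prod.Lex.toLex_lt_toLex]) a
  refine not_strictMono_of_wellFoundedGT (fun i => r (H.z i a)) fun i j hij => ?_
  refine (hr _ (hm i) _ (hm j)).1
    ((H.sub_lay 1 i j fun k s l t => ?_).posD Γ (H.pos i j hij 1 a a hc))
  have := hij.not_gt
  fin_cases k <;> fin_cases l <;> cases s <;> cases t <;>
    simp [tab, pat, split, Prod.Lex.toLex_lt_toLex, hij, this]

theorem not_interleaved_of_lt (hΓ : Γ.TwoToThree) {a b : Fin 3} (hab : a < b) :
    ¬ H.c 0 b a := by
  intro hc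
  refine not_posD_of_supplies hΓ (F := fun k => H.E k) (y := fun k => H.z k)
    (fun k => H.marked k) ?_ hab (H.pos 0 1 Nat.zero_lt_one 0 b a hc)
  exact disjoint_left.2 fun x h0 h1 => absurd (H.disj _ _ x h0 h1) (by simp)

theorem before (hΓ : Γ.TwoToThree) (a : Fin 3) : H.c 3 a a := by
  by_contra hc
  by_cases hn : H.c 2 a a
  · obtain ⟨r, hr⟩ := H.exists_rank_of_table hΓ ![0, 1, 2] (by decide) ![(1, 2), (3, 5), (0, 4)]
      (by unfold PInj; decide) (by decide)
    have h1 := (hr 2 0 2 (by decide) (by decide) a a).1 hn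
    have h2 := (hr 1 1 2 (by decide) (by decide) a a).2 (H.interleaved_dual hΓ a)
    have h3 := (hr 3 0 1 (by decide) (by decide) a a).2 hc
    exact lt_irrefl _ (h1.trans (h2.trans h3))
  · obtain ⟨r, hr⟩ := H.exists_rank_of_table hΓ ![0, 1, 2] (by decide) ![(0, 2), (3, 4), (1, 5)]
      (by unfold PInj; decide) (by decide)
    have h1 := (hr 0 0 2 (by decide) (by decide) a a).1 (H.interleaved hΓ a)
    have h2 := (hr 2 1 2 (by decide) (by decide) a a).2 hn
    have h3 := (hr 3 0 1 (by decide) (by decide) a a).2 hc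
    exact lt_irrefl _ (h1.trans (h2.trans h3))

theorem after (hΓ : Γ.TwoToThree) (a : Fin 3) : ¬ H.c 4 a a := by
  intro hc
  by_cases hn : H.c 2 a a
  · obtain ⟨r, hr⟩ := H.exists_rank_of_table hΓ ![1, 0, 2] (by decide) ![(1, 2), (3, 5), (0, 4)]
      (by unfold PInj; decide) (by decide)
    have h1 := (hr 2 0 2 (by decide) (by decide) a a).1 hn
    have h2 := (hr 1 1 2 (by decide) (by decide) a a).2 (H.interleaved_dual hΓ a)
    have h3 := (hr 4 1 0 (by decide) (by decide) a a).1 hc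
    exact lt_irrefl _ (h1.trans (h2.trans h3))
  · obtain ⟨r, hr⟩ := H.exists_rank_of_table hΓ ![1, 0, 2] (by decide) ![(0, 2), (3, 4), (1, 5)]
      (by unfold PInj; decide) (by decide)
    have h1 := (hr 0 0 2 (by decide) (by decide) a a).1 (H.interleaved hΓ a)
    have h2 := (hr 2 1 2 (by decide) (by decide) a a).2 hn
    have h3 := (hr 4 1 0 (by decide) (by decide) a a).1 hc
    exact lt_irrefl _ (h1.trans (h2.trans h3))

/-- If `a` and `b` behave alike for nested blocks, marked elements of sequential blocks are
compared in the order opposite to the one of the blocks. -/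
theorem not_before_of_lt (hΓ : Γ.TwoToThree) {a b : Fin 3} (hab : a < b)
    (hn : H.c 2 a a ↔ H.c 2 b b) : ¬ H.c 3 b a := by
  intro hc
  have hX := H.not_interleaved_of_lt hΓ hab
  by_cases ha : H.c 2 a a
  · obtain ⟨r, hr⟩ := H.exists_rank_of_table hΓ ![0, 1, 2, 3] (by decide)
      ![(2, 4), (5, 6), (0, 3), (1, 7)] (by unfold PInj; decide) (by decide)
    have h1 := (hr 1 0 2 (by decide) (by decide) b b).2 (H.interleaved_dual hΓ b)
    have h2 := (hr 3 0 1 (by decide) (by decide) b a).1 hc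
    have h3 := (hr 2 1 3 (by decide) (by decide) a a).1 ha
    have h4 := (hr 0 2 3 (by decide) (by decide) b a).2 hX
    exact lt_irrefl _ (h1.trans (h2.trans (h3.trans h4)))
  · obtain ⟨r, hr⟩ := H.exists_rank_of_table hΓ ![0, 1, 2, 3] (by decide)
      ![(1, 2), (3, 5), (0, 6), (4, 7)] (by unfold PInj; decide) (by decide)
    have h1 := (hr 2 0 2 (by decide) (by decide) b b).2 (hn.not.1 ha)
    have h2 := (hr 3 0 1 (by decide) (by decide) b a).1 hc
    have h3 := (hr 0 1 3 (by decide) (by decide) a a).1 (H.interleaved hΓ a)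
    have h4 := (hr 0 2 3 (by decide) (by decide) b a).2 hX
    exact lt_irrefl _ (h1.trans (h2.trans (h3.trans h4)))

theorem exists_alike : ∃ a b : Fin 3, a < b ∧ (H.c 2 a a ↔ H.c 2 b b) := by
  by_cases h01 : H.c 2 0 0 ↔ H.c 2 1 1
  · exact ⟨0, 1, by decide, h01⟩
  by_cases h02 : H.c 2 0 0 ↔ H.c 2 2 2
  · exact ⟨0, 2, by decide, h02⟩
  · exact ⟨1, 2, by decide, by tauto⟩

theorem false_of_twoToThree {Γ : EnumOp} (H : Homog Γ) (hΓ : Γ.TwoToThree) : False := by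
  obtain ⟨a, b, hab, hn⟩ := H.exists_alike
  obtain ⟨r, ri, hr⟩ :=
    (hΓ.1 _ (isCopy_parity H.disj fun i => (H.marked i).proper)).exists_rank
  have hm : ∀ i d, H.z i d ∈ Γ.memD (lay H.E parity) := fun i d =>
    H.mem_lay Function.injective_id (p := parity) (k := i)
      (by simp [parity, Prod.Lex.toLex_lt_toLex]) d
  have hlt : ∀ i d j d', (H.z i d, H.z j d') ∈ Γ.posD (lay H.E parity) →
      r (H.z i d) < r (H.z j d') := fun i d j d' h => (hr _ (hm i d) _ (hm j d')).1 h
  have hbefore : ∀ i j, i < j → i % 2 ≤ j % 2 →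
      (two (H.E i) (H.E j) (pat 3)).Sub (lay H.E parity) := by
    intro i j hij hmod
    refine H.sub_lay 3 i j fun k s l t => ?_
    fin_cases k <;> fin_cases l <;> cases s <;> cases t <;>
      simp [tab, pat, parity_lt] <;> omega
  have hafter : ∀ i j, i < j → j % 2 < i % 2 →
      (two (H.E i) (H.E j) (pat 4)).Sub (lay H.E parity) := by
    intro i j hij hmod
    refine H.sub_lay 4 i j fun k s l t => ?_
    fin_cases k <;> fin_cases l <;> cases s <;> cases t <;>
      simp [tab, pat, parity_lt] <;> omega
  have hsame : ∀ i j d, i < j → i % 2 ≤ j % 2 → r (H.z i d) < r (H.z j d) := fun i j d h h' =>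
    hlt _ _ _ _ ((hbefore i j h h').posD Γ (H.pos i j h 3 d d (H.before hΓ d)))
  have hback : ∀ i j d, i < j → j % 2 < i % 2 → r (H.z j d) < r (H.z i d) := fun i j d h h' =>
    hlt _ _ _ _ ((hafter i j h h').posD Γ (H.neg i j h 4 d d (H.after hΓ d)))
  have hcross : ∀ i j, i < j → i % 2 ≤ j % 2 → r (H.z j a) < r (H.z i b) := fun i j h h' =>
    hlt _ _ _ _ ((hbefore i j h h').posD Γ (H.neg i j h 3 b a (H.not_before_of_lt hΓ hab hn)))
  have hinj : ∀ q d, Function.Injective fun n => H.z (2 * n + q) d := by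
    intro q d m n h
    rcases lt_trichotomy m n with h' | h' | h'
    · exact absurd h (H.ne _ _ (by omega) d d)
    · exact h'
    · exact absurd h.symm (H.ne _ _ (by omega) d d)
  have h1 := EnumOp.fst_rank_lt ri (x := H.z 0 a) (y := H.z 1 a) (fun n => hm (2 * n + 2) a)
    (hinj 2 a) fun n => ⟨hsame 0 _ a (by omega) (by omega), hback 1 _ a (by omega) (by omega)⟩
  have h2 := EnumOp.fst_rank_lt ri (x := H.z 1 a) (y := H.z 0 b) (fun n => hm (2 * n + 3) a)
    (hinj 3 a) fun n => ⟨hsame 1 _ a (by omega) (by omega), hcross 0 _ (by omega) (by omega)⟩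
  have h3 := EnumOp.fst_rank_lt ri (x := H.z 0 b) (y := H.z 1 b) (fun n => hm (2 * n + 2) b)
    (hinj 2 b) fun n => ⟨hsame 0 _ b (by omega) (by omega), hback 1 _ b (by omega) (by omega)⟩
  omega

end Homog

end Block

/-- No enumeration operator embeds the pair `{ω·2, ω*·2}` into the pair `{ω·3, ω*·3}`. -/
theorem EnumOp.not_twoToThree (Γ : EnumOp) : ¬ Γ.TwoToThree := fun hΓ =>
  let ⟨H⟩ := Block.nonempty_homog hΓ
  H.false_of_twoToThree hΓ

end embedding

/-- if `Γ : {ω·2, ω*·2} ≤_c {ω·3, ω*·3}` then for every copy `A`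
of `ω`, `Γ(A)` is a linear order of type `ω`; in particular `Γ(A)` contains no
suborder of type `ω·2` nor of type `ω+1`. -/
theorem omega_to_omega (Γ : EnumOp)
    (hΓ : Γ.Embeds (Lex (Fin 2 × ℕ)) ((Lex (Fin 2 × ℕ))ᵒᵈ)
      (Lex (Fin 3 × ℕ)) ((Lex (Fin 3 × ℕ))ᵒᵈ))
    (L : LinDiag) (hL : IsCopy ℕ L) :
    Γ.OutOfType ℕ L ∧ ¬ Γ.OutContains (Lex (Fin 2 × ℕ)) L ∧
      ¬ Γ.OutContains (WithTop ℕ) L := by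
  exact (Γ.not_twoToThree hΓ).elim
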